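/- Let T1 and T2 be two incompatible unrooted binary phylogenetic trees on the same label set X and let X*|X** be a common split of T1 and T2. Let p = tw(D(T1|X*, T2|X*)) and q = tw(D(T1|X**, T2|X**)). Then max(p,q) ≤ tw(D(T1,T2)) ≤ max(p,q) + 1. -/

import Mathlib

open SimpleGraph

/-- `G` has a tree decomposition of width at most `k`: a tree `t` together with
bags satisfying (tw1), (tw2) and (tw3), all of whose bags have size at most `k+1`. -/
def HasTreeDecompWidthLE {V : Type*} (G : SimpleGraph V) (k : ℕ) : Prop :=
  ∃ (n : ℕ) (t : SimpleGraph (Fin (n + 1))) (bag : Fin (n + 1) → Finset V),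
    t.IsTree ∧
    (∀ v : V, ∃ i, v ∈ bag i) ∧
    (∀ u v : V, G.Adj u v → ∃ i, u ∈ bag i ∧ v ∈ bag i) ∧
    (∀ v : V, (t.induce {i | v ∈ bag i}).Connected) ∧
    (∀ i, (bag i).card ≤ k + 1)

/-- The treewidth of a graph: the least `k` such that `G` has a tree decomposition
of width `k`. -/
noncomputable def treewidth {V : Type*} (G : SimpleGraph V) : ℕ :=
  sInf {k | HasTreeDecompWidthLE G k}

/-- An unrooted binary phylogenetic graph (tree or network) on label set `X`:
a finite connected graph whose degree-1 vertices are bijectively labelled by `X`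
and all of whose other vertices have degree 3. -/
structure PhyloGraph (V : Type*) (X : Type*) where
  graph : SimpleGraph V
  finite : Finite V
  connected : graph.Connected
  leaf : X → V
  leaf_inj : Function.Injective leaf
  leaf_deg : ∀ x : X, (graph.neighborSet (leaf x)).ncard = 1
  internal_deg : ∀ v : V, (∀ x : X, leaf x ≠ v) → (graph.neighborSet v).ncard = 3

/-- An unrooted binary phylogenetic tree on label set `X`. -/
structure PhyloTree (V : Type*) (X : Type*) extends PhyloGraph V X where
  acyclic : graph.IsAcyclic

open Classical in
/-- The map identifying a leaf of the second graph with the leaf of the first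
graph carrying the same label. -/
noncomputable def mergeMap {V1 V2 X : Type*} (l1 : X → V1) (l2 : X → V2) :
    V1 ⊕ V2 → V1 ⊕ V2
  | Sum.inl v => Sum.inl v
  | Sum.inr w => if h : ∃ x, l2 x = w then Sum.inl (l1 h.choose) else Sum.inr w

lemma mergeMap_idem {V1 V2 X : Type*} (l1 : X → V1) (l2 : X → V2) (u : V1 ⊕ V2) :
    mergeMap l1 l2 (mergeMap l1 l2 u) = mergeMap l1 l2 u := by
  classical
  cases u with
  | inl v => rfl
  | inr w =>
    by_cases h : ∃ x, l2 x = w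
    · simp [mergeMap, h]
    · simp [mergeMap, h]

/-- The vertex set of the display graph: the disjoint union of the vertex sets
of the two graphs, with leaves carrying the same label identified. -/
def DisplayVertex {V1 V2 X : Type*} (l1 : X → V1) (l2 : X → V2) : Type _ :=
  {u : V1 ⊕ V2 // mergeMap l1 l2 u = u}

/-- The canonical map from `V1 ⊕ V2` to the vertex set of the display graph. -/
noncomputable def toDisplay {V1 V2 X : Type*} (l1 : X → V1) (l2 : X → V2) (u : V1 ⊕ V2) :
    DisplayVertex l1 l2 :=
  ⟨mergeMap l1 l2 u, mergeMap_idem l1 l2 u⟩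

/-- The display graph of two leaf-labelled graphs: their disjoint union with the
leaves carrying the same label identified. -/
noncomputable def displayGraph {V1 V2 X : Type*} (G1 : SimpleGraph V1) (l1 : X → V1)
    (G2 : SimpleGraph V2) (l2 : X → V2) : SimpleGraph (DisplayVertex l1 l2) :=
  SimpleGraph.fromRel (fun a b =>
    (∃ u v : V1, G1.Adj u v ∧ a = toDisplay l1 l2 (Sum.inl u) ∧ b = toDisplay l1 l2 (Sum.inl v)) ∨
    (∃ u v : V2, G2.Adj u v ∧ a = toDisplay l1 l2 (Sum.inr u) ∧ b = toDisplay l1 l2 (Sum.inr v)))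

/-- The treewidth distance between two phylogenetic trees:
`d_tw(T1,T2) = tw(D(T1,T2)) - 2`. -/
noncomputable def dtw {V1 V2 X : Type*} (T1 : PhyloTree V1 X) (T2 : PhyloTree V2 X) : ℕ :=
  treewidth (displayGraph T1.graph T1.leaf T2.graph T2.leaf) - 2

/-- Two phylogenetic trees are compatible if there is a label-preserving
isomorphism between them. -/
def Compatible {V1 V2 X : Type*} (T1 : PhyloTree V1 X) (T2 : PhyloTree V2 X) : Prop :=
  ∃ φ : T1.graph ≃g T2.graph, ∀ x : X, φ (T1.leaf x) = T2.leaf x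

/-- The support of the path between `a` and `b` in `G` (in a tree or forest
there is at most one such path). -/
def pathSupport {V : Type*} (G : SimpleGraph V) (a b : V) : Set V :=
  {v | ∃ w : G.Walk a b, w.IsPath ∧ v ∈ w.support}

/-- The leaf-labelled graph `(G, l)` displays the quartet `ab|cd`: the path from
`a` to `b` and the path from `c` to `d` are vertex-disjoint. -/
def QuartetSplit {V X : Type*} (G : SimpleGraph V) (l : X → V) (a b c d : X) : Prop :=
  pathSupport G (l a) (l b) ∩ pathSupport G (l c) (l d) = ∅

/-- `R` is the restriction `T|Y` of `T` to the label set `Y`: the tree obtained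
from the minimal subtree of `T` spanning the leaves labelled by `Y` by
suppressing degree-2 vertices. (A binary tree is determined by its displayed
quartets, so this is characterised by: `R` displays exactly the quartets on `Y`
that `T` displays.) -/
def IsRestriction {V X W : Type*} (T : PhyloTree V X) (Y : Set X)
    (R : PhyloTree W {x : X // x ∈ Y}) : Prop :=
  ∀ a b c d : {x : X // x ∈ Y},
    a ≠ b → a ≠ c → a ≠ d → b ≠ c → b ≠ d → c ≠ d →
    (QuartetSplit R.graph R.leaf a b c d ↔ QuartetSplit T.graph T.leaf a.1 b.1 c.1 d.1)

/-- The edge `{a, b}` of the tree `T` induces the split `Xs | Xss`: deleting it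
separates the leaves labelled by `Xs` (on the `a` side) from those labelled by
`Xss` (on the `b` side). -/
def SplitAt {V X : Type*} (T : PhyloTree V X) (Xs Xss : Set X) (a b : V) : Prop :=
  T.graph.Adj a b ∧
  (∀ x ∈ Xs, (T.graph.deleteEdges {s(a, b)}).Reachable a (T.leaf x)) ∧
  (∀ x ∈ Xss, (T.graph.deleteEdges {s(a, b)}).Reachable b (T.leaf x))

/-- The display graph of `T1` and `T2` with the two edges `{u1,v1}` (of `T1`)
and `{u2,v2}` (of `T2`) inducing a common split deleted. -/
noncomputable def splitDeletedDisplay {V1 V2 X : Type*} (T1 : PhyloTree V1 X)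
    (T2 : PhyloTree V2 X) (u1 v1 : V1) (u2 v2 : V2) :
    SimpleGraph (DisplayVertex T1.leaf T2.leaf) :=
  (displayGraph T1.graph T1.leaf T2.graph T2.leaf).deleteEdges
    {s(toDisplay T1.leaf T2.leaf (Sum.inl u1), toDisplay T1.leaf T2.leaf (Sum.inl v1)),
     s(toDisplay T1.leaf T2.leaf (Sum.inr u2), toDisplay T1.leaf T2.leaf (Sum.inr v2))}

/-- The connected component of the vertex `r` of `T1` in the display graph with
the two split-inducing edges deleted. -/
noncomputable def splitComponent {V1 V2 X : Type*} (T1 : PhyloTree V1 X)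
    (T2 : PhyloTree V2 X) (u1 v1 : V1) (u2 v2 : V2) (r : V1) :
    Set (DisplayVertex T1.leaf T2.leaf) :=
  {w | (splitDeletedDisplay T1 T2 u1 v1 u2 v2).Reachable
    (toDisplay T1.leaf T2.leaf (Sum.inl r)) w}

/-- The "rooted" part `G*` (resp. `G**`) of the display graph on one side of a
common split: the component of `r` after deleting the two split-inducing edges. -/
noncomputable def splitSide {V1 V2 X : Type*} (T1 : PhyloTree V1 X)
    (T2 : PhyloTree V2 X) (u1 v1 : V1) (u2 v2 : V2) (r : V1) :
    SimpleGraph (splitComponent T1 T2 u1 v1 u2 v2 r) :=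
  (splitDeletedDisplay T1 T2 u1 v1 u2 v2).induce (splitComponent T1 T2 u1 v1 u2 v2 r)

/-- The graph `[G*]` (resp. `[G**]`): the side `G*` of the display graph together
with the edge joining its two "roots" `r` (a vertex of `T1`) and `s` (a vertex
of `T2`). -/
noncomputable def splitSidePlus {V1 V2 X : Type*} (T1 : PhyloTree V1 X)
    (T2 : PhyloTree V2 X) (u1 v1 : V1) (u2 v2 : V2) (r : V1) (s : V2) :
    SimpleGraph (splitComponent T1 T2 u1 v1 u2 v2 r) :=
  SimpleGraph.fromRel (fun x y =>
    (splitDeletedDisplay T1 T2 u1 v1 u2 v2).Adj x.1 y.1 ∨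
    (x.1 = toDisplay T1.leaf T2.leaf (Sum.inl r) ∧
     y.1 = toDisplay T1.leaf T2.leaf (Sum.inr s)))

/-! ### Betweenness in graphs -/

/-- `v` lies between `a` and `b`: every walk from `a` to `b` meets `v`. -/
def GBtw {V : Type*} (G : SimpleGraph V) (a v b : V) : Prop :=
  ∀ w : G.Walk a b, v ∈ w.support

section Between

variable {V : Type*} {G : SimpleGraph V}

lemma btw_left (a b : V) : GBtw G a a b := fun w => w.start_mem_support
lemma btw_right (a b : V) : GBtw G a b b := fun w => w.end_mem_support

lemma GBtw.symm {a v b : V} (h : GBtw G a v b) : GBtw G b v a := fun w => by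
  have := h w.reverse
  simpa using this

lemma btw_comm {a v b : V} : GBtw G a v b ↔ GBtw G b v a := ⟨GBtw.symm, GBtw.symm⟩

lemma btw_self {a v : V} (h : GBtw G a v a) : v = a := by
  simpa using h Walk.nil

lemma GBtw.trich {a v c : V} (h : GBtw G a v c) (b : V) : GBtw G a v b ∨ GBtw G b v c := by
  by_contra hcon
  simp only [GBtw, not_or, not_forall] at hcon
  obtain ⟨⟨p, hp⟩, ⟨q, hq⟩⟩ := hcon
  have := h (p.append q)
  rw [Walk.mem_support_append_iff] at this
  tauto

lemma GBtw.sub {x u y v : V} (h : GBtw G x u y) (h2 : GBtw G x v u) : GBtw G x v y := fun w => by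
  classical
  exact w.support_takeUntil_subset_support (h w) (h2 (w.takeUntil u (h w)))

lemma btw_adj {a v b : V} (hab : G.Adj a b) (h : GBtw G a v b) : v = a ∨ v = b := by
  simpa using h (Walk.cons hab Walk.nil)

lemma GBtw.dist (hc : G.Connected) {a v b : V} (h : GBtw G a v b) :
    G.dist a b = G.dist a v + G.dist v b := by
  classical
  apply le_antisymm
  · exact hc.dist_triangle
  · obtain ⟨p, hp⟩ := hc.exists_walk_length_eq_dist a b
    have h1 := congrArg Walk.length (p.take_spec (h p))
    rw [Walk.length_append] at h1
    have h2 := SimpleGraph.dist_le (p.takeUntil v (h p))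
    have h3 := SimpleGraph.dist_le (p.dropUntil v (h p))
    omega

lemma GBtw.antisymm (hc : G.Connected) {a u v : V} (h : GBtw G a v u) (h2 : GBtw G a u v) :
    u = v := by
  have h1 := h.dist hc
  have h3 := h2.dist hc
  have : G.dist u v = 0 := by omega
  exact (hc.dist_eq_zero_iff).1 this

/-- In an acyclic graph, one end of an edge is always between the other end and any vertex. -/
lemma btw_edge (ha : G.IsAcyclic) {c d : V} (hcd : G.Adj c d) (a : V) :
    GBtw G a d c ∨ GBtw G a c d := by
  by_contra hcon
  simp only [GBtw, not_or, not_forall] at hcon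
  obtain ⟨⟨p, hp⟩, ⟨q, hq⟩⟩ := hcon
  have hb := (isAcyclic_iff_forall_adj_isBridge.1 ha) hcd
  rw [isBridge_iff_forall_walk_mem_edges] at hb
  have := hb (p.reverse.append q)
  rw [Walk.edges_append, List.mem_append] at this
  rcases this with h | h
  · have := Walk.snd_mem_support_of_mem_edges _ h
    simp at this
    exact hp this
  · exact hq (Walk.fst_mem_support_of_mem_edges _ h)

lemma btw_of_path (ha : G.IsAcyclic) {a b v : V} (w : G.Walk a b) (hw : w.IsPath)
    (hv : v ∈ w.support) : GBtw G a v b := fun q => by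
  classical
  have h := ha.path_unique ⟨w, hw⟩ q.toPath
  have h2 : w = q.bypass := congrArg Subtype.val h
  rw [h2] at hv
  exact q.support_bypass_subset_support hv

lemma mem_pathSupport_iff (hc : G.Connected) (ha : G.IsAcyclic) {a b v : V} :
    v ∈ pathSupport G a b ↔ GBtw G a v b := by
  classical
  constructor
  · rintro ⟨w, hw, hv⟩
    exact btw_of_path ha w hw hv
  · intro h
    obtain ⟨p⟩ := hc.preconnected a b
    exact ⟨p.bypass, p.bypass_isPath, h _⟩

/-- Medians exist in trees. -/
lemma exists_median (hc : G.Connected) (ha : G.IsAcyclic) (a b c : V) :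
    ∃ m, GBtw G a m b ∧ GBtw G b m c ∧ GBtw G a m c := by
  obtain ⟨p⟩ := hc.preconnected a c
  have key : ∀ (x y : V) (_ : G.Walk x y), (∃ m, GBtw G a m b ∧ GBtw G b m x ∧ GBtw G a m x) →
      ∃ m, GBtw G a m b ∧ GBtw G b m y ∧ GBtw G a m y := by
    intro x y p
    induction p with
    | nil => exact id
    | @cons x z y hxz p ih =>
      rintro ⟨m, h1, h2, h3⟩
      apply ih
      by_cases h : GBtw G b m z ∧ GBtw G a m z
      · exact ⟨m, h1, h⟩
      have hm : m = x := by
        by_contra hmx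
        apply h
        constructor
        · rcases h2.trich z with h | h
          · exact h
          · rcases btw_adj hxz.symm h with h | h
            · rw [h]; exact btw_right _ _
            · exact absurd h hmx
        · rcases h3.trich z with h | h
          · exact h
          · rcases btw_adj hxz.symm h with h | h
            · rw [h]; exact btw_right _ _
            · exact absurd h hmx
      subst hm
      refine ⟨z, ?_, btw_right _ _, btw_right _ _⟩
      rcases btw_edge ha hxz a with h4 | h4
      · exact h1.sub h4
      rcases btw_edge ha hxz b with h5 | h5
      · exact (h1.symm.sub h5).symm
      exact absurd ⟨h5, h4⟩ h
  exact key a c p ⟨a, btw_left _ _, btw_right _ _, btw_left _ _⟩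

lemma median_unique (hc : G.Connected) {a b c u v : V}
    (h1 : GBtw G a v b) (h2 : GBtw G b v c) (h3 : GBtw G a v c)
    (g1 : GBtw G a u b) (g2 : GBtw G b u c) (g3 : GBtw G a u c) : u = v := by
  have A : ∀ x, GBtw G x v u → GBtw G x u v → u = v := fun x h h' => h.antisymm hc h'
  have A1 := h1.trich u
  have A2 := h2.trich u
  have A3 := h3.trich u
  have B1 := g1.trich v
  have B2 := g2.trich v
  have B3 := g3.trich v
  rw [btw_comm (a := u)] at A1 A2 A3
  rw [btw_comm (a := v)] at B1 B2 B3
  have Aa := A a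
  have Ab := A b
  have Ac := A c
  tauto

lemma adj_iff_btw (hc : G.Connected) (ha : G.IsAcyclic) {u v : V} :
    G.Adj u v ↔ u ≠ v ∧ ∀ w, GBtw G u w v → w = u ∨ w = v := by
  classical
  constructor
  · intro h
    exact ⟨h.ne, fun w hw => btw_adj h hw⟩
  · rintro ⟨hne, h⟩
    obtain ⟨p⟩ := hc.preconnected u v
    have hp := p.bypass_isPath
    generalize p.bypass = q at hp
    cases q with
    | nil => exact absurd rfl hne
    | @cons _ z _ huz q =>
      have := btw_of_path ha _ hp (v := z) (by simp)
      rcases h z this with h | h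
      · exact absurd h huz.ne'
      · exact h ▸ huz

/-- two neighbours cannot both be towards `v` -/
lemma nbr_toward_unique (hc : G.Connected) {v z z1 z2 : V} (h1 : G.Adj z z1) (h2 : G.Adj z z2)
    (g1 : GBtw G v z1 z) (g2 : GBtw G v z2 z) : z1 = z2 := by
  have k1 : GBtw G v z1 z2 := by
    rcases g1.trich z2 with h | h
    · exact h
    · rcases btw_adj h2.symm h with h | h
      · rw [h]; exact btw_right _ _
      · exact absurd h h1.ne'
  have k2 : GBtw G v z2 z1 := by
    rcases g2.trich z1 with h | h
    · exact h
    · rcases btw_adj h1.symm h with h | h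
      · rw [h]; exact btw_right _ _
      · exact absurd h h2.ne'
  exact k2.antisymm hc k1

/-- Every branch of a finite tree (inside a region `P`) contains a leaf. -/
lemma exists_leaf_branch [Finite V] (hc : G.Connected) (ha : G.IsAcyclic) (P L : V → Prop)
    (hP : ∀ z, P z → L z ∨ ∃ z1 z2, z1 ≠ z2 ∧ G.Adj z z1 ∧ G.Adj z z2 ∧ P z1 ∧ P z2)
    {v n : V} (hn : P n) :
    ∃ z, P z ∧ L z ∧ GBtw G v n z := by
  have hfin : {z | P z ∧ GBtw G v n z}.Finite := Set.toFinite _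
  obtain ⟨z, ⟨hz1, hz2⟩, hmax⟩ := hfin.exists_maximalFor (fun z => G.dist v z) _
    ⟨n, hn, btw_right _ _⟩
  rcases hP z hz1 with h | ⟨z1, z2, hne, a1, a2, p1, p2⟩
  · exact ⟨z, hz1, h, hz2⟩
  exfalso
  have fin : ∀ z', G.Adj z z' → P z' → GBtw G v z z' → False := by
    intro z' a p hb
    have h1 := hmax (j := z') ⟨p, hb.sub hz2⟩
    have h2 := hb.dist hc
    have h3 : 0 < G.dist z z' := hc.pos_dist_of_ne a.ne
    simp only at h1
    have := h1 (by omega)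
    omega
  rcases btw_edge ha a1 v with h | h
  · rcases btw_edge ha a2 v with h' | h'
    · exact hne (nbr_toward_unique hc a1 a2 h h')
    · exact fin _ a2 p2 h'
  · exact fin _ a1 p1 h

end Between

/-! ### Quartets determine the betweenness of the essential vertices -/

section Transfer

/-- The `a b` path and the `c d` path meet. -/
def Meet {V : Type*} (G : SimpleGraph V) (a b c d : V) : Prop :=
  ∃ u, GBtw G a u b ∧ GBtw G c u d

/-- `v` is the median of three labelled leaves. -/
def IsMed {V Y : Type*} (G : SimpleGraph V) (l : Y → V) (v : V) (a b c : Y) : Prop :=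
  GBtw G (l a) v (l b) ∧ GBtw G (l b) v (l c) ∧ GBtw G (l a) v (l c)

/-- `v` is a median of some labelled leaves. -/
def Ess {V Y : Type*} (G : SimpleGraph V) (l : Y → V) (v : V) : Prop :=
  ∃ a b c, IsMed G l v a b c

variable {V W Y : Type*} {G : SimpleGraph V} {H : SimpleGraph W} {l : Y → V} {l' : Y → W}

lemma not_meet_of_not_btw (hc : G.Connected) {x y b c v : V} (h : ¬ GBtw G x v y)
    (h1 : GBtw G x v b) (h2 : GBtw G x v c) : ¬ Meet G x y b c := by
  rintro ⟨u, hu1, hu2⟩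
  have hxu : ¬ GBtw G x v u := fun h' => h (hu1.sub h')
  have hub : GBtw G b v u := ((h1.trich u).resolve_left hxu).symm
  have huc : GBtw G c v u := ((h2.trich u).resolve_left hxu).symm
  have huv : u = v := by
    rcases hu2.trich v with h' | h'
    · exact hub.antisymm hc h'
    · exact huc.antisymm hc h'.symm
  subst huv
  exact hxu (btw_right _ _)

lemma btw_leaf_iff (hc : G.Connected) {v a b c : V}
    (h1 : GBtw G a v b) (h2 : GBtw G b v c) (h3 : GBtw G a v c) (x y : V) :
    GBtw G x v y ↔ Meet G x y a b ∧ Meet G x y b c ∧ Meet G x y a c := by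
  constructor
  · intro h
    exact ⟨⟨v, h, h1⟩, ⟨v, h, h2⟩, ⟨v, h, h3⟩⟩
  · rintro ⟨m1, m2, m3⟩
    by_contra h
    have A1 := h1.trich x
    have A2 := h2.trich x
    have A3 := h3.trich x
    rw [btw_comm (b := x)] at A1 A2 A3
    have B1 := fun p q => not_meet_of_not_btw hc (b := a) (c := b) h p q m1
    have B2 := fun p q => not_meet_of_not_btw hc (b := b) (c := c) h p q m2
    have B3 := fun p q => not_meet_of_not_btw hc (b := a) (c := c) h p q m3
    tauto

lemma btw_ess_iff (hc : G.Connected) {v : V} (hv : Ess G l v) (z w : V) :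
    GBtw G z w v ↔ ∀ y, GBtw G z v (l y) → GBtw G z w (l y) := by
  constructor
  · intro h y hy
    exact hy.sub h
  · intro h
    by_contra hn
    obtain ⟨a, b, c, h1, h2, h3⟩ := hv
    have hwv : w ≠ v := by
      rintro rfl
      exact hn (btw_right _ _)
    have key : ∀ y, GBtw G z v (l y) → GBtw G (l y) w v := by
      intro y hy
      exact (((h y hy).trich v).resolve_left hn).symm
    have A1 := h1.trich z
    have A2 := h2.trich z
    have A3 := h3.trich z
    rw [btw_comm (b := z)] at A1 A2 A3
    have B : ∀ x y, GBtw G x v y → GBtw G x w v → GBtw G y w v → False := by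
      intro x y hxy hx hy
      rcases hxy.trich w with h | h
      · exact hwv (h.antisymm hc hx)
      · exact hwv (h.symm.antisymm hc hy)
    have B1 := B _ _ h1
    have B2 := B _ _ h2
    have B3 := B _ _ h3
    have ka := key a
    have kb := key b
    have kc := key c
    tauto

lemma corr_of_med (hcG : G.Connected) (hcH : H.Connected)
    (hQ : ∀ a b c d, Meet G (l a) (l b) (l c) (l d) ↔ Meet H (l' a) (l' b) (l' c) (l' d))
    {v : V} {w : W} {a b c : Y} (hv : IsMed G l v a b c) (hw : IsMed H l' w a b c) (x y : Y) :
    GBtw G (l x) v (l y) ↔ GBtw H (l' x) w (l' y) := by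
  rw [btw_leaf_iff hcG hv.1 hv.2.1 hv.2.2, btw_leaf_iff hcH hw.1 hw.2.1 hw.2.2, hQ, hQ, hQ]

theorem exists_transfer (hcG : G.Connected) (haG : G.IsAcyclic) (hcH : H.Connected)
    (haH : H.IsAcyclic)
    (hQ : ∀ a b c d, Meet G (l a) (l b) (l c) (l d) ↔ Meet H (l' a) (l' b) (l' c) (l' d))
    (hE : ∀ w, Ess H l' w) :
    ∃ φ : W → V, Function.Injective φ ∧ (∀ w, Ess G l (φ w)) ∧
      (∀ v, Ess G l v → ∃ w, φ w = v) ∧ (∀ y, φ (l' y) = l y) ∧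
      ∀ a w b, GBtw H a w b ↔ GBtw G (φ a) (φ w) (φ b) := by
  have hex : ∀ w, ∃ v, Ess G l v ∧ ∀ x y, GBtw G (l x) v (l y) ↔ GBtw H (l' x) w (l' y) := by
    intro w
    obtain ⟨a, b, c, hw⟩ := hE w
    obtain ⟨v, hv⟩ := exists_median hcG haG (l a) (l b) (l c)
    exact ⟨v, ⟨a, b, c, hv⟩, corr_of_med hcG hcH hQ hv hw⟩
  choose φ hφE hφ using hex
  have hsurj : ∀ v, Ess G l v → ∃ w, φ w = v := by
    rintro v ⟨a, b, c, hv⟩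
    obtain ⟨w, hw⟩ := exists_median hcH haH (l' a) (l' b) (l' c)
    refine ⟨w, ?_⟩
    exact median_unique hcG hv.1 hv.2.1 hv.2.2 ((hφ w _ _).2 hw.1) ((hφ w _ _).2 hw.2.1)
      ((hφ w _ _).2 hw.2.2)
  have hleaf : ∀ y, φ (l' y) = l y := by
    intro y
    exact btw_self ((hφ (l' y) y y).2 (btw_left _ _))
  have t1 : ∀ (x : Y) (w v : W), GBtw H (l' x) w v ↔ GBtw G (l x) (φ w) (φ v) := by
    intro x w v
    rw [btw_ess_iff hcH (hE v), btw_ess_iff hcG (hφE v)]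
    simp only [hφ]
  have t2 : ∀ a w b, GBtw H a w b ↔ GBtw G (φ a) (φ w) (φ b) := by
    intro a w b
    rw [btw_ess_iff hcH (hE b), btw_ess_iff hcG (hφE b)]
    apply forall_congr'
    intro y
    rw [btw_comm, t1, btw_comm, btw_comm (a := a), t1, btw_comm (a := l y)]
  refine ⟨φ, ?_, hφE, hsurj, hleaf, t2⟩
  intro w w' h
  have h1 : GBtw H w' w w' := (t2 _ _ _).2 (by rw [h]; exact btw_left _ _)
  exact btw_self h1

end Transfer

/-! ### The structure of a restriction to one side of a split -/

section Struct

variable {V W X : Type*} {G : SimpleGraph V}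

lemma leaf_btw_nbr (hc : G.Connected) {a n z : V} (h : ∀ z, G.Adj a z → z = n)
    (hb : GBtw G z a n) : z = a := by
  classical
  by_contra hne
  obtain ⟨p⟩ := hc.preconnected a z
  have hp := p.bypass_isPath
  generalize p.bypass = q at hp
  cases q with
  | nil => exact hne rfl
  | @cons _ m _ ham q =>
    have := h _ ham
    subst this
    have h1 := hb.symm q
    rw [Walk.cons_isPath_iff] at hp
    exact hp.2 h1

lemma exists_first_step (hc : G.Connected) (ha : G.IsAcyclic) {u a : V} (hne : a ≠ u) :
    ∃ n, G.Adj u n ∧ GBtw G u n a := by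
  classical
  obtain ⟨p⟩ := hc.preconnected u a
  have hp := p.bypass_isPath
  generalize p.bypass = q at hp
  cases q with
  | nil => exact absurd rfl hne
  | @cons _ m _ ham q => exact ⟨m, ham, btw_of_path ha _ hp (by simp)⟩

lemma btw_nbrs (ha : G.IsAcyclic) {w n1 n2 : V} (h1 : G.Adj w n1) (h2 : G.Adj w n2)
    (hne : n1 ≠ n2) : GBtw G n1 w n2 := by
  rcases btw_edge ha h2 n1 with h | h
  · rcases btw_adj h1.symm h with h | h
    · exact absurd h.symm hne
    · exact absurd h h2.ne'
  · exact h

lemma not_btw_branch (hc : G.Connected) {w n x : V} (h1 : G.Adj w n) (hx : GBtw G w n x) :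
    ¬ GBtw G x w n := fun h => h1.ne' (h.antisymm hc hx.symm)

lemma btw_branches (hc : G.Connected) (ha : G.IsAcyclic) {w n1 n2 x y : V} (h1 : G.Adj w n1)
    (h2 : G.Adj w n2) (hne : n1 ≠ n2) (hx : GBtw G w n1 x) (hy : GBtw G w n2 y) :
    GBtw G x w y := by
  have k := btw_nbrs ha h1 h2 hne
  have a1 := not_btw_branch hc h1 hx
  have a2 := not_btw_branch hc h2 hy
  rcases k.trich x with h | h
  · exact absurd h.symm a1
  · rcases h.trich y with h | h
    · exact h
    · exact absurd h a2

namespace PhyloTree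

variable (T : PhyloTree V X)

lemma leaf_nbr (x : X) : ∃ n, ∀ z, T.graph.Adj (T.leaf x) z ↔ z = n := by
  obtain ⟨n, hn⟩ := Set.ncard_eq_one.1 (T.leaf_deg x)
  refine ⟨n, fun z => ?_⟩
  rw [← SimpleGraph.mem_neighborSet, hn, Set.mem_singleton_iff]

lemma internal_nbr (v : V) (hv : ∀ x, T.leaf x ≠ v) : ∃ a b c, a ≠ b ∧ a ≠ c ∧ b ≠ c ∧
    ∀ z, T.graph.Adj v z ↔ z = a ∨ z = b ∨ z = c := by
  obtain ⟨a, b, c, h1, h2, h3, h⟩ := Set.ncard_eq_three.1 (T.internal_deg v hv)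
  refine ⟨a, b, c, h1, h2, h3, fun z => ?_⟩
  rw [← SimpleGraph.mem_neighborSet, h]
  simp

lemma leaf_btw {a : X} {c d : V} (h : GBtw T.graph c (T.leaf a) d) :
    T.leaf a = c ∨ T.leaf a = d := by
  obtain ⟨n, hn⟩ := T.leaf_nbr a
  rcases h.trich n with h | h
  · exact Or.inl (leaf_btw_nbr T.connected (fun z => (hn z).1) h).symm
  · exact Or.inr (leaf_btw_nbr T.connected (fun z => (hn z).1) h.symm).symm

lemma meet_iff_of_eq {a b c d : X}
    (h : ¬ (a ≠ b ∧ a ≠ c ∧ a ≠ d ∧ b ≠ c ∧ b ≠ d ∧ c ≠ d)) :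
    Meet T.graph (T.leaf a) (T.leaf b) (T.leaf c) (T.leaf d) ↔
      a = c ∨ a = d ∨ b = c ∨ b = d := by
  constructor
  · rintro ⟨u, h1, h2⟩
    by_contra hcon
    push Not at hcon
    obtain ⟨k1, k2, k3, k4⟩ := hcon
    by_cases hab : a = b
    · subst hab
      have := btw_self h1
      subst this
      rcases T.leaf_btw h2 with h | h
      · exact k1 (T.leaf_inj h)
      · exact k2 (T.leaf_inj h)
    by_cases hcd : c = d
    · subst hcd
      have := btw_self h2
      subst this
      rcases T.leaf_btw h1 with h | h
      · exact k1 (T.leaf_inj h).symm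
      · exact k3 (T.leaf_inj h).symm
    exact h ⟨hab, k1, k2, k3, k4, hcd⟩
  · rintro (rfl | rfl | rfl | rfl)
    · exact ⟨_, btw_left _ _, btw_left _ _⟩
    · exact ⟨_, btw_left _ _, btw_right _ _⟩
    · exact ⟨_, btw_right _ _, btw_left _ _⟩
    · exact ⟨_, btw_right _ _, btw_right _ _⟩

lemma quartetSplit_iff (a b c d : X) : QuartetSplit T.graph T.leaf a b c d ↔
    ¬ Meet T.graph (T.leaf a) (T.leaf b) (T.leaf c) (T.leaf d) := by
  unfold QuartetSplit Meet
  rw [Set.eq_empty_iff_forall_notMem]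
  simp only [Set.mem_inter_iff, mem_pathSupport_iff T.connected T.acyclic, not_exists]

lemma meet_restriction (Y : Set X) (R : PhyloTree W {x : X // x ∈ Y}) (hR : IsRestriction T Y R)
    (a b c d : {x : X // x ∈ Y}) :
    Meet T.graph (T.leaf a.1) (T.leaf b.1) (T.leaf c.1) (T.leaf d.1) ↔
    Meet R.graph (R.leaf a) (R.leaf b) (R.leaf c) (R.leaf d) := by
  by_cases h : (a ≠ b ∧ a ≠ c ∧ a ≠ d ∧ b ≠ c ∧ b ≠ d ∧ c ≠ d)
  · obtain ⟨h1, h2, h3, h4, h5, h6⟩ := h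
    have := hR a b c d h1 h2 h3 h4 h5 h6
    rw [quartetSplit_iff, quartetSplit_iff] at this
    tauto
  · rw [R.meet_iff_of_eq h, T.meet_iff_of_eq]
    · simp only [Subtype.ext_iff]
    · simpa only [ne_eq, Subtype.ext_iff] using h

/-- Every vertex has, in each direction, a labelled leaf. -/
lemma exists_leaf_dir (v n : V) : ∃ x, GBtw T.graph v n (T.leaf x) := by
  have := T.finite
  obtain ⟨z, _, ⟨x, rfl⟩, h⟩ := exists_leaf_branch (V := V) T.connected T.acyclic
    (fun _ => True) (fun z => ∃ x, T.leaf x = z) (by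
      intro z _
      by_cases hz : ∃ x, T.leaf x = z
      · exact Or.inl hz
      · obtain ⟨a, b, c, h1, h2, h3, h⟩ := T.internal_nbr z (by simpa using hz)
        exact Or.inr ⟨a, b, h1, (h a).2 (by simp), (h b).2 (by simp), trivial, trivial⟩)
    (v := v) (n := n) trivial
  exact ⟨x, h⟩

lemma ess_all (w : V) : Ess T.graph T.leaf w := by
  by_cases hw : ∃ x, T.leaf x = w
  · obtain ⟨x, rfl⟩ := hw
    exact ⟨x, x, x, btw_left _ _, btw_left _ _, btw_left _ _⟩
  · obtain ⟨a, b, c, h1, h2, h3, h⟩ := T.internal_nbr w (by simpa using hw)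
    obtain ⟨x, hx⟩ := T.exists_leaf_dir w a
    obtain ⟨y, hy⟩ := T.exists_leaf_dir w b
    obtain ⟨z, hz⟩ := T.exists_leaf_dir w c
    have ka := (h a).2 (by simp)
    have kb := (h b).2 (by simp)
    have kc := (h c).2 (by simp)
    exact ⟨x, y, z, btw_branches T.connected T.acyclic ka kb h1 hx hy,
      btw_branches T.connected T.acyclic kb kc h3 hy hz,
      btw_branches T.connected T.acyclic ka kc h2 hx hz⟩

lemma exists_ne_label (T : PhyloTree V X) (x : X) : ∃ y : X, y ≠ x := by
  obtain ⟨n, hn⟩ := T.leaf_nbr x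
  obtain ⟨y, hy⟩ := T.exists_leaf_dir (T.leaf x) n
  refine ⟨y, ?_⟩
  rintro rfl
  have := btw_self hy
  exact ((hn n).2 rfl).ne this.symm

/-- The conclusion of the structure lemma. -/
structure Side (Y : Set X) (u v : V) (R : PhyloTree W {x : X // x ∈ Y}) (φ : W → V)
    (n1 n2 : V) : Prop where
  inj : Function.Injective φ
  mem : ∀ w, GBtw T.graph (φ w) u v
  ne : ∀ w, φ w ≠ u
  surj : ∀ z, GBtw T.graph z u v → z ≠ u → ∃ w, φ w = z
  leaf : ∀ y, φ (R.leaf y) = T.leaf y.1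
  hne : n1 ≠ n2
  hne1 : n1 ≠ v
  hne2 : n2 ≠ v
  nbr : ∀ z, T.graph.Adj u z ↔ z = v ∨ z = n1 ∨ z = n2
  leaf_ne : ∀ x, T.leaf x ≠ u
  adj : ∀ w w', R.graph.Adj w w' ↔ T.graph.Adj (φ w) (φ w') ∨
    (φ w = n1 ∧ φ w' = n2) ∨ (φ w = n2 ∧ φ w' = n1)

variable {T}

lemma side_convex {u v p s p' : V} (hp : GBtw T.graph p u v) (hp' : GBtw T.graph p' u v)
    (h : GBtw T.graph p s p') : GBtw T.graph s u v := by
  have aux : ∀ p, GBtw T.graph p u v → GBtw T.graph p s u → GBtw T.graph s u v := by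
    intro p hp hs
    rcases hp.trich s with h | h
    · rw [h.antisymm T.connected hs]
      exact btw_left _ _
    · exact h
  rcases h.trich u with h | h
  · exact aux p hp h
  · exact aux p' hp' h.symm

lemma side_nbr {u v z z' : V} (huv : T.graph.Adj u v) (hz : GBtw T.graph z u v)
    (ha : T.graph.Adj z z') : GBtw T.graph z' u v ∨ (z = u ∧ z' = v) := by
  rcases hz.trich z' with h | h
  · rcases btw_adj ha h with h | h
    · subst h
      by_cases hv : z' = v
      · exact Or.inr ⟨rfl, hv⟩
      · exact Or.inl (btw_nbrs T.acyclic ha huv hv)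
    · subst h
      exact Or.inl (btw_left _ _)
  · exact Or.inl h

theorem exists_side {Y : Set X} {u v : V} (huv : T.graph.Adj u v)
    (hY : ∀ x, x ∈ Y ↔ GBtw T.graph (T.leaf x) u v)
    (R : PhyloTree W {x : X // x ∈ Y}) (hR : IsRestriction T Y R) :
    ∃ φ n1 n2, T.Side Y u v R φ n1 n2 := by
  have := T.finite
  have hc := T.connected
  have hac := T.acyclic
  have hPv : ¬ GBtw T.graph v u v := fun h => huv.ne (btw_self h)
  have leaf_ne : ∀ x, T.leaf x ≠ u := by
    rintro x rfl
    have hxY : x ∈ Y := (hY x).2 (btw_left _ _)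
    obtain ⟨⟨y, hy⟩, hne⟩ := R.exists_ne_label ⟨x, hxY⟩
    have h1 := (hY y).1 hy
    obtain ⟨n, hn⟩ := T.leaf_nbr x
    have hvn := (hn v).1 huv
    subst hvn
    have := leaf_btw_nbr hc (fun z => (hn z).1) h1
    exact hne (Subtype.ext (T.leaf_inj this))
  obtain ⟨n1, n2, hne, hne1, hne2, hnbr⟩ : ∃ n1 n2, n1 ≠ n2 ∧ n1 ≠ v ∧ n2 ≠ v ∧
      ∀ z, T.graph.Adj u z ↔ z = v ∨ z = n1 ∨ z = n2 := by
    obtain ⟨a, b, c, h1, h2, h3, h⟩ := T.internal_nbr u leaf_ne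
    rcases (h v).1 huv with rfl | rfl | rfl
    · exact ⟨b, c, h3, h1.symm, h2.symm, h⟩
    · exact ⟨a, c, h2, h1, h3.symm, fun z => by rw [h]; tauto⟩
    · exact ⟨a, b, h1, h2, h3, fun z => by rw [h]; tauto⟩
  have hPL : ∀ z, GBtw T.graph z u v → (∃ y : {x : X // x ∈ Y}, T.leaf y.1 = z) ∨
      ∃ z1 z2, z1 ≠ z2 ∧ T.graph.Adj z z1 ∧ T.graph.Adj z z2 ∧ GBtw T.graph z1 u v ∧
        GBtw T.graph z2 u v := by
    intro z hz
    by_cases hl : ∃ x, T.leaf x = z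
    · obtain ⟨x, rfl⟩ := hl
      exact Or.inl ⟨⟨x, (hY x).2 hz⟩, rfl⟩
    · right
      obtain ⟨a, b, c, h1, h2, h3, h⟩ := T.internal_nbr z (by simpa using hl)
      have ka := (h a).2 (by simp)
      have kb := (h b).2 (by simp)
      have kc := (h c).2 (by simp)
      rcases side_nbr huv hz ka with pa | ⟨-, pa⟩
      · rcases side_nbr huv hz kb with pb | ⟨-, pb⟩
        · exact ⟨a, b, h1, ka, kb, pa, pb⟩
        · rcases side_nbr huv hz kc with pc | ⟨-, pc⟩
          · exact ⟨a, c, h2, ka, kc, pa, pc⟩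
          · exact absurd (pb.trans pc.symm) h3
      · rcases side_nbr huv hz kb with pb | ⟨-, pb⟩
        · rcases side_nbr huv hz kc with pc | ⟨-, pc⟩
          · exact ⟨b, c, h3, kb, kc, pb, pc⟩
          · exact absurd (pa.trans pc.symm) h2
        · exact absurd (pa.trans pb.symm) h1
  have hdir : ∀ v' n, GBtw T.graph n u v →
      ∃ y : {x : X // x ∈ Y}, GBtw T.graph v' n (T.leaf y.1) := by
    intro v' n hn
    obtain ⟨z, _, ⟨y, rfl⟩, h⟩ := exists_leaf_branch hc hac _ _ hPL (v := v') hn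
    exact ⟨y, h⟩
  have hess : ∀ z, Ess T.graph (fun y : {x : X // x ∈ Y} => T.leaf y.1) z ↔
      GBtw T.graph z u v ∧ z ≠ u := by
    intro z
    constructor
    · rintro ⟨a, b, c, h1, h2, h3⟩
      refine ⟨side_convex ((hY _).1 a.2) ((hY _).1 b.2) h1, ?_⟩
      rintro rfl
      have hd : ∀ a : {x : X // x ∈ Y}, ∃ n, T.graph.Adj z n ∧ (n = n1 ∨ n = n2) ∧
          GBtw T.graph z n (T.leaf a.1) := by
        intro a
        obtain ⟨n, hn, hb⟩ := exists_first_step hc hac (leaf_ne a.1)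
        refine ⟨n, hn, ?_, hb⟩
        rcases (hnbr n).1 hn with h | h
        · exfalso
          subst h
          exact hn.ne (hb.symm.antisymm hc ((hY _).1 a.2))
        · exact h
      have hs : ∀ (a b : V) n, T.graph.Adj z n → GBtw T.graph z n a → GBtw T.graph z n b →
          GBtw T.graph a z b → False := by
        intro a b n hn ha hb h
        rcases h.trich n with h | h
        · exact not_btw_branch hc hn ha h
        · exact not_btw_branch hc hn hb h.symm
      obtain ⟨na, ha1, ha2, ha3⟩ := hd a
      obtain ⟨nb, hb1, hb2, hb3⟩ := hd b
      obtain ⟨nc, hc1, hc2, hc3⟩ := hd c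
      have q1 : na ≠ nb := by
        rintro rfl
        exact hs _ _ _ ha1 ha3 hb3 h1
      have q2 : nb ≠ nc := by
        rintro rfl
        exact hs _ _ _ hb1 hb3 hc3 h2
      have q3 : na ≠ nc := by
        rintro rfl
        exact hs _ _ _ ha1 ha3 hc3 h3
      rcases ha2 with rfl | rfl <;> rcases hb2 with rfl | rfl <;> rcases hc2 with rfl | rfl <;>
        simp_all
    · rintro ⟨hz, hzu⟩
      by_cases hl : ∃ x, T.leaf x = z
      · obtain ⟨x, rfl⟩ := hl
        let y : {x : X // x ∈ Y} := ⟨x, (hY x).2 hz⟩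
        exact ⟨y, y, y, btw_left _ _, btw_left _ _, btw_left _ _⟩
      · obtain ⟨a, b, c, h1, h2, h3, h⟩ := T.internal_nbr z (by simpa using hl)
        have ka := (h a).2 (by simp)
        have kb := (h b).2 (by simp)
        have kc := (h c).2 (by simp)
        have ff : ∀ a, T.graph.Adj z a → GBtw T.graph a u v := fun a ka =>
          (side_nbr huv hz ka).resolve_right (fun h => hzu h.1)
        obtain ⟨x, hx⟩ := hdir z a (ff a ka)
        obtain ⟨y, hy⟩ := hdir z b (ff b kb)
        obtain ⟨w, hw⟩ := hdir z c (ff c kc)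
        exact ⟨x, y, w, btw_branches hc hac ka kb h1 hx hy,
          btw_branches hc hac kb kc h3 hy hw, btw_branches hc hac ka kc h2 hx hw⟩
  obtain ⟨φ, hinj, hE, hsurj, hleaf, hbtw⟩ := exists_transfer hc hac R.connected R.acyclic
    (l := fun y : {x : X // x ∈ Y} => T.leaf y.1) (l' := R.leaf)
    (T.meet_restriction Y R hR) R.ess_all
  have hmem : ∀ w, GBtw T.graph (φ w) u v := fun w => ((hess _).1 (hE w)).1
  have hneu : ∀ w, φ w ≠ u := fun w => ((hess _).1 (hE w)).2
  have hsurj' : ∀ z, GBtw T.graph z u v → z ≠ u → ∃ w, φ w = z :=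
    fun z h1 h2 => hsurj z ((hess z).2 ⟨h1, h2⟩)
  refine ⟨φ, n1, n2, hinj, hmem, hneu, hsurj', hleaf, hne, hne1, hne2, hnbr, leaf_ne, ?_⟩
  have hnv : ∀ w, φ w ≠ v := by
    intro w h
    have := hmem w
    rw [h] at this
    exact hPv this
  intro w w'
  constructor
  · intro hadj
    by_contra hcon
    push Not at hcon
    obtain ⟨c1, c2, c3⟩ := hcon
    have hpp : φ w ≠ φ w' := fun h => hadj.ne (hinj h)
    have hin : ∀ s, GBtw T.graph (φ w) s (φ w') → s = φ w ∨ s = φ w' ∨ s = u := by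
      intro s hs
      by_cases hsu : s = u
      · exact Or.inr (Or.inr hsu)
      · obtain ⟨z, rfl⟩ := hsurj' s (side_convex (hmem w) (hmem w') hs) hsu
        rcases btw_adj hadj ((hbtw _ _ _).2 hs) with h | h
        · exact Or.inl (by rw [h])
        · exact Or.inr (Or.inl (by rw [h]))
    have hu : GBtw T.graph (φ w) u (φ w') := by
      by_contra hu
      apply c1
      rw [adj_iff_btw hc hac]
      refine ⟨hpp, fun s hs => ?_⟩
      rcases hin s hs with h | h | h
      · exact Or.inl h
      · exact Or.inr h
      · subst h
        exact absurd hs hu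
    have a1 : T.graph.Adj u (φ w) := by
      apply SimpleGraph.Adj.symm
      rw [adj_iff_btw hc hac]
      refine ⟨hneu w, fun s hs => ?_⟩
      rcases hin s (hu.sub hs) with h | h | h
      · exact Or.inl h
      · subst h
        exact absurd (hu.antisymm hc hs) (hneu w')
      · exact Or.inr h
    have a2 : T.graph.Adj u (φ w') := by
      apply SimpleGraph.Adj.symm
      rw [adj_iff_btw hc hac]
      refine ⟨hneu w', fun s hs => ?_⟩
      rcases hin s (hu.symm.sub hs).symm with h | h | h
      · subst h
        exact absurd (hu.symm.antisymm hc hs) (hneu w)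
      · exact Or.inl h
      · exact Or.inr h
    have b1 := ((hnbr _).1 a1).resolve_left (hnv w)
    have b2 := ((hnbr _).1 a2).resolve_left (hnv w')
    rcases b1 with b1 | b1 <;> rcases b2 with b2 | b2
    · exact hpp (b1.trans b2.symm)
    · exact c2 b1 b2
    · exact c3 b1 b2
    · exact hpp (b1.trans b2.symm)
  · have k1 := (hnbr n1).2 (by simp)
    have k2 := (hnbr n2).2 (by simp)
    have main : ∀ w w', φ w = n1 → φ w' = n2 → R.graph.Adj w w' := by
      intro w w' h1 h2
      rw [adj_iff_btw R.connected R.acyclic]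
      refine ⟨fun h => hne (by rw [← h1, ← h2, h]), fun z hz => ?_⟩
      have hz' := (hbtw _ _ _).1 hz
      rw [h1, h2] at hz'
      rcases hz'.trich u with h | h
      · rcases btw_adj k1.symm h with h | h
        · exact Or.inl (hinj (h.trans h1.symm))
        · exact absurd h (hneu z)
      · rcases btw_adj k2 h with h | h
        · exact absurd h (hneu z)
        · exact Or.inr (hinj (h.trans h2.symm))
    rintro (h | ⟨h1, h2⟩ | ⟨h1, h2⟩)
    · rw [adj_iff_btw R.connected R.acyclic]
      refine ⟨fun h' => h.ne (by rw [h']), fun z hz => ?_⟩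
      rcases btw_adj h ((hbtw _ _ _).1 hz) with h | h
      · exact Or.inl (hinj h)
      · exact Or.inr (hinj h)
    · exact main w w' h1 h2
    · exact (main w' w h2 h1).symm

end PhyloTree

end Struct

/-! ### Tree decompositions -/

/-- The underlying data of a tree decomposition, with convexity in place of connectedness. -/
structure TDec (V : Type*) where
  ι : Type
  fin : Finite ι
  t : SimpleGraph ι
  tree : t.IsTree
  bag : ι → Set V
  conv : ∀ v i m j, v ∈ bag i → v ∈ bag j → GBtw t i m j → v ∈ bag m

/-- `D` is a tree decomposition of `G` of width at most `k`. -/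
structure TDec.IsFor {V : Type*} (D : TDec V) (G : SimpleGraph V) (k : ℕ) : Prop where
  cover : ∀ v, ∃ i, v ∈ D.bag i
  edge : ∀ u v, G.Adj u v → ∃ i, u ∈ D.bag i ∧ v ∈ D.bag i
  card : ∀ i, (D.bag i).ncard ≤ k + 1

lemma GBtw.exists_of_hom {A B : Type*} {G : SimpleGraph A} {G' : SimpleGraph B} (f : G →g G')
    {a b : A} (p : G.Walk a b) {a' b' m' : B} (h : GBtw G' a' m' b') (ha : f a = a')
    (hb : f b = b') : ∃ x ∈ p.support, f x = m' := by
  subst ha hb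
  have := h (p.map f)
  rwa [Walk.support_map, List.mem_map] at this

section TD

variable {V : Type*} {G : SimpleGraph V}

lemma convex_of_connected_induce {ι : Type*} {t : SimpleGraph ι} {S : Set ι}
    (h : (t.induce S).Preconnected) {i m j : ι} (hi : i ∈ S) (hj : j ∈ S) (hm : GBtw t i m j) :
    m ∈ S := by
  obtain ⟨p⟩ := h ⟨i, hi⟩ ⟨j, hj⟩
  obtain ⟨x, _, rfl⟩ := hm.exists_of_hom (SimpleGraph.Embedding.induce S).toHom p rfl rfl
  exact x.2

lemma connected_induce_of_convex {ι : Type*} {t : SimpleGraph ι} (ht : t.IsTree) {S : Set ι}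
    (hne : S.Nonempty) (h : ∀ i m j, i ∈ S → j ∈ S → GBtw t i m j → m ∈ S) :
    (t.induce S).Connected := by
  classical
  obtain ⟨s, hs⟩ := hne
  have : Nonempty S := ⟨⟨s, hs⟩⟩
  refine ⟨?_⟩
  rintro ⟨i, hi⟩ ⟨j, hj⟩
  obtain ⟨p⟩ := ht.connected.preconnected i j
  have hp := p.bypass_isPath
  generalize p.bypass = q at hp
  exact ⟨q.induce S (fun m hm => h i m j hi hj (btw_of_path ht.isAcyclic q hp hm))⟩

lemma TDec.IsFor.toHas [Finite V] {D : TDec V} {k : ℕ} (h : D.IsFor G k) :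
    HasTreeDecompWidthLE G k := by
  classical
  have := D.fin
  have := Fintype.ofFinite V
  have hne : Nonempty D.ι := D.tree.connected.nonempty
  obtain ⟨n, ⟨e⟩⟩ := Finite.exists_equiv_fin D.ι
  obtain ⟨m, rfl⟩ : ∃ m, n = m + 1 := by
    cases n with
    | zero => exact (e hne.some).elim0
    | succ m => exact ⟨m, rfl⟩
  have htree : (D.t.comap e.symm).IsTree :=
    (SimpleGraph.Iso.comap e.symm D.t).isTree_iff.2 D.tree
  refine ⟨m, D.t.comap e.symm, fun i => (D.bag (e.symm i)).toFinset, htree, ?_, ?_, ?_, ?_⟩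
  · intro v
    obtain ⟨i, hi⟩ := h.cover v
    exact ⟨e i, by simpa using hi⟩
  · intro u v huv
    obtain ⟨i, hi, hi'⟩ := h.edge u v huv
    exact ⟨e i, by simpa using hi, by simpa using hi'⟩
  · intro v
    apply connected_induce_of_convex htree
    · obtain ⟨i, hi⟩ := h.cover v
      exact ⟨e i, by simpa using hi⟩
    · intro i x j hi hj hb
      simp only [Set.mem_toFinset, Set.mem_ofPred_eq] at hi hj ⊢
      apply D.conv v _ _ _ hi hj
      intro p
      obtain ⟨y, hy, hyx⟩ := hb.exists_of_hom (SimpleGraph.Iso.comap e.symm D.t).symm.toHom p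
        (by exact e.apply_symm_apply i) (by exact e.apply_symm_apply j)
      have : e y = x := hyx
      rw [← this]
      simpa using hy
  · intro i
    have := h.card (e.symm i)
    rwa [Set.ncard_eq_toFinset_card'] at this

lemma exists_isFor {k : ℕ} (h : HasTreeDecompWidthLE G k) : ∃ D : TDec V, D.IsFor G k := by
  obtain ⟨n, t, bag, h1, h2, h3, h4, h5⟩ := h
  refine ⟨⟨Fin (n + 1), inferInstance, t, h1, fun i => (bag i : Set V), ?_⟩, ?_, ?_, ?_⟩
  · intro v i m j hi hj hb
    exact convex_of_connected_induce (S := {i | v ∈ bag i}) (h4 v).preconnected hi hj hb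
  · exact h2
  · exact h3
  · intro i
    simpa using h5 i

/-- one-bag decomposition data -/
def TDec.single (s : Set V) : TDec V where
  ι := Unit
  fin := inferInstance
  t := ⊥
  tree := IsTree.of_subsingleton
  bag := fun _ => s
  conv := fun _ _ _ _ h _ _ => h

lemma hasTD_nonempty [Finite V] (G : SimpleGraph V) : {k | HasTreeDecompWidthLE G k}.Nonempty := by
  refine ⟨Nat.card V, TDec.IsFor.toHas (D := TDec.single Set.univ) ⟨?_, ?_, ?_⟩⟩
  · exact fun v => ⟨(), trivial⟩
  · exact fun u v _ => ⟨(), trivial, trivial⟩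
  · intro i
    show (Set.univ : Set V).ncard ≤ _
    rw [Set.ncard_univ]
    omega

lemma hasTD_treewidth [Finite V] (G : SimpleGraph V) : HasTreeDecompWidthLE G (treewidth G) :=
  Nat.sInf_mem (hasTD_nonempty G)

lemma TDec.IsFor.mono {D : TDec V} {k k' : ℕ} (h : D.IsFor G k) (hk : k ≤ k') : D.IsFor G k' :=
  ⟨h.cover, h.edge, fun i => (h.card i).trans (by omega)⟩

lemma isTree_join {ι κ : Type} [Finite ι] [Finite κ] {s : SimpleGraph ι} {t : SimpleGraph κ}
    (hs : s.IsTree) (ht : t.IsTree) (i : ι) (j : κ) :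
    ((s ⊕g t) ⊔ edge (Sum.inl i) (Sum.inr j)).IsTree := by
  rw [isTree_iff_connected_and_card] at hs ht ⊢
  refine ⟨hs.1.sum_sup_edge ht.1, ?_⟩
  have h1 : ((s ⊕g t) ⊔ edge (Sum.inl i) (Sum.inr j)).edgeSet =
      insert s(Sum.inl i, Sum.inr j) (s ⊕g t).edgeSet := by
    rw [edgeSet_sup, edgeSet_edge_of_ne (by simp), Set.union_comm, Set.singleton_union]
  have h2 : s(Sum.inl i, Sum.inr j) ∉ (s ⊕g t).edgeSet := by simp
  rw [h1, Nat.card_coe_set_eq, Set.ncard_insert_of_notMem h2 (Set.toFinite _),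
    ← Nat.card_coe_set_eq, Nat.card_congr edgeSetSumEquiv, Nat.card_sum, Nat.card_sum]
  omega

/-- Joining two decompositions by an edge. -/
def TDec.join (D E : TDec V) (i : D.ι) (j : E.ι)
    (h : ∀ v a b, v ∈ D.bag a → v ∈ E.bag b → v ∈ D.bag i ∧ v ∈ E.bag j) : TDec V where
  ι := D.ι ⊕ E.ι
  fin := by
    have := D.fin
    have := E.fin
    infer_instance
  t := (D.t ⊕g E.t) ⊔ edge (Sum.inl i) (Sum.inr j)
  tree := by
    have := D.fin
    have := E.fin
    exact isTree_join D.tree E.tree i j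
  bag := Sum.elim D.bag E.bag
  conv := by
    let J := (D.t ⊕g E.t) ⊔ edge (Sum.inl i) (Sum.inr j)
    let fl : D.t →g J := (Hom.ofLE le_sup_left).comp Embedding.sumInl.toHom
    let fr : E.t →g J := (Hom.ofLE le_sup_left).comp Embedding.sumInr.toHom
    have hij : J.Adj (Sum.inl i) (Sum.inr j) := by simp [J, edge]
    have ll : ∀ a m b, GBtw J (Sum.inl a) (Sum.inl m) (Sum.inl b) → GBtw D.t a m b := by
      intro a m b hb p
      obtain ⟨x, hx, hxm⟩ := hb.exists_of_hom fl p rfl rfl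
      rwa [← Sum.inl_injective (show Sum.inl x = Sum.inl m from hxm)]
    have rr : ∀ a m b, GBtw J (Sum.inr a) (Sum.inr m) (Sum.inr b) → GBtw E.t a m b := by
      intro a m b hb p
      obtain ⟨x, hx, hxm⟩ := hb.exists_of_hom fr p rfl rfl
      rwa [← Sum.inr_injective (show Sum.inr x = Sum.inr m from hxm)]
    have lrl : ∀ a m b, ¬ GBtw J (Sum.inl a) (Sum.inr m) (Sum.inl b) := by
      intro a m b hb
      obtain ⟨p⟩ := D.tree.connected.preconnected a b
      obtain ⟨x, hx, hxm⟩ := hb.exists_of_hom fl p rfl rfl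
      exact absurd (show Sum.inl x = Sum.inr m from hxm) (by simp)
    have rlr : ∀ a m b, ¬ GBtw J (Sum.inr a) (Sum.inl m) (Sum.inr b) := by
      intro a m b hb
      obtain ⟨p⟩ := E.tree.connected.preconnected a b
      obtain ⟨x, hx, hxm⟩ := hb.exists_of_hom fr p rfl rfl
      exact absurd (show Sum.inr x = Sum.inl m from hxm) (by simp)
    have main : ∀ v a m b, v ∈ D.bag a → v ∈ E.bag b → GBtw J (Sum.inl a) m (Sum.inr b) →
        v ∈ Sum.elim D.bag E.bag m := by
      intro v a m b ha hb hm
      obtain ⟨hi, hj⟩ := h v a b ha hb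
      rcases hm.trich (Sum.inl i) with h1 | h1
      · cases m with
        | inl m => exact D.conv v _ _ _ ha hi (ll _ _ _ h1)
        | inr m => exact absurd h1 (lrl _ _ _)
      · rcases h1.trich (Sum.inr j) with h2 | h2
        · rcases btw_adj hij h2 with rfl | rfl
          · exact hi
          · exact hj
        · cases m with
          | inl m => exact absurd h2 (rlr _ _ _)
          | inr m => exact E.conv v _ _ _ hj hb (rr _ _ _ h2)
    rintro v (a | a) m (b | b) ha hb hm
    · cases m with
      | inl m => exact D.conv v _ _ _ ha hb (ll _ _ _ hm)
      | inr m => exact absurd hm (lrl _ _ _)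
    · exact main v a m b ha hb hm
    · exact main v b m a hb ha hm.symm
    · cases m with
      | inl m => exact absurd hm (rlr _ _ _)
      | inr m => exact E.conv v _ _ _ ha hb (rr _ _ _ hm)

/-- Some vertex has all its neighbours in a common bag. -/
lemma TDec.IsFor.exists_simplicial [Finite V] [Nonempty V] {D : TDec V} {k : ℕ}
    (h : D.IsFor G k) : ∃ v i, v ∈ D.bag i ∧ ∀ w, G.Adj v w → w ∈ D.bag i := by
  have := D.fin
  have hc := D.tree.connected
  have hac := D.tree.isAcyclic
  obtain ⟨r⟩ : Nonempty D.ι := hc.nonempty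
  have htop : ∀ v, ∃ i, v ∈ D.bag i ∧ ∀ j, v ∈ D.bag j → GBtw D.t r i j := by
    intro v
    obtain ⟨i, hi, hmin⟩ := (Set.toFinite {i | v ∈ D.bag i}).exists_minimalFor
      (fun i => D.t.dist r i) _ (h.cover v)
    refine ⟨i, hi, fun j hj => ?_⟩
    obtain ⟨m, m1, m2, m3⟩ := exists_median hc hac r i j
    have hm : v ∈ D.bag m := D.conv v _ _ _ hi hj m2
    have d := m1.dist hc
    have := hmin (j := m) hm (by simp only; omega)
    have : D.t.dist m i = 0 := by simp only at this; omega
    have := hc.dist_eq_zero_iff.1 this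
    rwa [← this]
  choose top htop1 htop2 using htop
  obtain ⟨v, _, hmax⟩ := (Set.toFinite (Set.univ : Set V)).exists_maximalFor
      (fun v => D.t.dist r (top v)) _ Set.univ_nonempty
  refine ⟨v, top v, htop1 v, fun w hw => ?_⟩
  obtain ⟨j, hj1, hj2⟩ := h.edge v w hw
  rcases (htop2 v j hj1).trich (top w) with h1 | h1
  · have d := h1.dist hc
    have : D.t.dist (top v) (top w) = 0 := by
      by_contra hne
      have := hmax (j := w) trivial (by simp only; omega)
      simp only at this
      omega
    rw [hc.dist_eq_zero_iff.1 this]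
    exact htop1 w
  · exact D.conv w _ _ _ (htop1 w) hj2 h1

/-- If every vertex has two distinct neighbours then the width is at least two. -/
lemma TDec.IsFor.two_le [Finite V] [Nonempty V] {D : TDec V} {k : ℕ} (h : D.IsFor G k)
    (hd : ∀ v, ∃ a b, a ≠ b ∧ G.Adj v a ∧ G.Adj v b) : 2 ≤ k := by
  obtain ⟨v, i, hv, hn⟩ := h.exists_simplicial
  obtain ⟨a, b, hab, ha, hb⟩ := hd v
  have h1 := h.card i
  have h2 : ({v, a, b} : Set V).ncard = 3 :=
    Set.ncard_eq_three.2 ⟨v, a, b, ha.ne, hb.ne, hab, rfl⟩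
  have h3 : ({v, a, b} : Set V).ncard ≤ (D.bag i).ncard := by
    apply Set.ncard_le_ncard _ (Set.toFinite _)
    rintro x (rfl | rfl | rfl)
    · exact hv
    · exact hn _ ha
    · exact hn _ hb
  omega

/-- Star minors: contracting stars does not increase the width. -/
lemma TDec.IsFor.minor {K : Type*} [Finite V] {H : SimpleGraph K} {D : TDec V} {k : ℕ}
    (h : D.IsFor G k) (B : K → Set V) (c : K → V) (hcB : ∀ x, c x ∈ B x)
    (hstar : ∀ x, ∀ v ∈ B x, v = c x ∨ G.Adj (c x) v)
    (hdisj : ∀ x y v, v ∈ B x → v ∈ B y → x = y)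
    (hadj : ∀ x y, H.Adj x y → ∃ v ∈ B x, ∃ w ∈ B y, G.Adj v w) :
    ∃ E : TDec K, E.IsFor H k := by
  have hac := D.tree.isAcyclic
  have hc := D.tree.connected
  refine ⟨⟨D.ι, D.fin, D.t, D.tree, fun i => {x | ∃ v ∈ B x, v ∈ D.bag i}, ?_⟩, ?_, ?_, ?_⟩
  · rintro x i m j ⟨v, hv, hvi⟩ ⟨w, hw, hwj⟩ hb
    have aux : ∀ v i, v ∈ B x → v ∈ D.bag i → ∃ i', c x ∈ D.bag i' ∧
        (GBtw D.t i m i' → v ∈ D.bag m) := by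
      intro v i hv hvi
      rcases hstar x v hv with rfl | ha
      · exact ⟨i, hvi, fun h => D.conv _ _ _ _ hvi hvi h⟩
      · obtain ⟨i', h1, h2⟩ := h.edge _ _ ha
        exact ⟨i', h1, fun h => D.conv _ _ _ _ hvi h2 h⟩
    obtain ⟨i', hi', hi2⟩ := aux v i hv hvi
    obtain ⟨j', hj', hj2⟩ := aux w j hw hwj
    rcases hb.trich i' with hb | hb
    · exact ⟨v, hv, hi2 hb⟩
    · rcases hb.trich j' with hb | hb
      · exact ⟨c x, hcB x, D.conv _ _ _ _ hi' hj' hb⟩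
      · exact ⟨w, hw, hj2 hb.symm⟩
  · intro x
    obtain ⟨i, hi⟩ := h.cover (c x)
    exact ⟨i, c x, hcB x, hi⟩
  · intro x y hxy
    obtain ⟨v, hv, w, hw, hvw⟩ := hadj x y hxy
    obtain ⟨i, h1, h2⟩ := h.edge _ _ hvw
    exact ⟨i, ⟨v, hv, h1⟩, ⟨w, hw, h2⟩⟩
  · intro i
    refine le_trans ?_ (h.card i)
    let f : K → V := fun x => by
      classical
      exact if hx : ∃ v ∈ B x, v ∈ D.bag i then hx.choose else c x
    have hf : ∀ x ∈ {x | ∃ v ∈ B x, v ∈ D.bag i}, f x ∈ B x ∧ f x ∈ D.bag i := by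
      intro x hx
      have : ∃ v ∈ B x, v ∈ D.bag i := hx
      simp only [f, this, dif_pos]
      exact this.choose_spec
    apply Set.ncard_le_ncard_of_injOn f (fun x hx => (hf x hx).2)
    · intro x hx y hy hxy
      exact hdisj x y (f x) (hf x hx).1 (hxy ▸ (hf y hy).1)

end TD

/-! ### The display graph -/

section Display

variable {V1 V2 X : Type*} {l1 : X → V1} {l2 : X → V2}

lemma disp_leaf (h2 : Function.Injective l2) (x : X) :
    toDisplay l1 l2 (Sum.inr (l2 x)) = toDisplay l1 l2 (Sum.inl (l1 x)) := by
  have h : ∃ y, l2 y = l2 x := ⟨x, rfl⟩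
  apply Subtype.ext
  simp only [toDisplay, mergeMap]
  rw [dif_pos h]
  congr 2
  exact h2 h.choose_spec

lemma disp_inr_val {w : V2} (h : ∀ x, l2 x ≠ w) :
    (toDisplay l1 l2 (Sum.inr w)).1 = Sum.inr w := by
  simp only [toDisplay, mergeMap]
  rw [dif_neg (by rintro ⟨x, hx⟩; exact h x hx)]

lemma disp_inl_val (v : V1) : (toDisplay l1 l2 (Sum.inl v)).1 = Sum.inl v := rfl

lemma disp_inl_inj : Function.Injective (fun v => toDisplay l1 l2 (Sum.inl v)) := by
  intro v w h
  exact Sum.inl_injective (congrArg Subtype.val h)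

lemma disp_inl_eq_inr (h2 : Function.Injective l2) {v : V1} {w : V2} :
    toDisplay l1 l2 (Sum.inl v) = toDisplay l1 l2 (Sum.inr w) ↔ ∃ x, l1 x = v ∧ l2 x = w := by
  constructor
  · intro h
    by_cases hw : ∃ x, l2 x = w
    · obtain ⟨x, rfl⟩ := hw
      rw [disp_leaf h2] at h
      exact ⟨x, (disp_inl_inj h).symm, rfl⟩
    · have := congrArg Subtype.val h
      rw [disp_inr_val (by simpa using hw), disp_inl_val] at this
      simp at this
  · rintro ⟨x, rfl, rfl⟩
    exact (disp_leaf h2 x).symm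

lemma disp_inr_inj (h1 : Function.Injective l1) (h2 : Function.Injective l2) :
    Function.Injective (fun v => toDisplay l1 l2 (Sum.inr v)) := by
  intro v w h
  simp only at h
  by_cases hv : ∃ x, l2 x = v
  · obtain ⟨x, rfl⟩ := hv
    rw [disp_leaf h2, disp_inl_eq_inr h2] at h
    obtain ⟨y, hy, rfl⟩ := h
    rw [h1 hy]
  · by_cases hw : ∃ x, l2 x = w
    · obtain ⟨x, rfl⟩ := hw
      rw [disp_leaf h2] at h
      obtain ⟨y, hy, rfl⟩ := (disp_inl_eq_inr h2).1 h.symm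
      rw [h1 hy]
    · have := congrArg Subtype.val h
      rw [disp_inr_val (by simpa using hv), disp_inr_val (by simpa using hw)] at this
      exact Sum.inr_injective this

lemma disp_cases (a : DisplayVertex l1 l2) :
    (∃ v, a = toDisplay l1 l2 (Sum.inl v)) ∨ ∃ w, (∀ x, l2 x ≠ w) ∧
      a = toDisplay l1 l2 (Sum.inr w) := by
  obtain ⟨v | w, h⟩ := a
  · exact Or.inl ⟨v, rfl⟩
  · right
    have hw : ∀ x, l2 x ≠ w := by
      intro x hx
      simp only [mergeMap] at h
      rw [dif_pos ⟨x, hx⟩] at h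
      simp at h
    exact ⟨w, hw, Subtype.ext (disp_inr_val hw).symm⟩

lemma disp_finite [Finite V1] [Finite V2] : Finite (DisplayVertex l1 l2) :=
  inferInstanceAs (Finite {u : V1 ⊕ V2 // mergeMap l1 l2 u = u})

lemma disp_adj {G1 : SimpleGraph V1} {G2 : SimpleGraph V2} (h1 : Function.Injective l1)
    (h2 : Function.Injective l2) {a b : DisplayVertex l1 l2} :
    (displayGraph G1 l1 G2 l2).Adj a b ↔
    (∃ u v : V1, G1.Adj u v ∧ a = toDisplay l1 l2 (Sum.inl u) ∧ b = toDisplay l1 l2 (Sum.inl v)) ∨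
    (∃ u v : V2, G2.Adj u v ∧ a = toDisplay l1 l2 (Sum.inr u) ∧
      b = toDisplay l1 l2 (Sum.inr v)) := by
  rw [displayGraph, SimpleGraph.fromRel_adj]
  constructor
  · rintro ⟨-, (h | h) | ⟨u, v, h, rfl, rfl⟩ | ⟨u, v, h, rfl, rfl⟩⟩
    · exact Or.inl h
    · exact Or.inr h
    · exact Or.inl ⟨v, u, h.symm, rfl, rfl⟩
    · exact Or.inr ⟨v, u, h.symm, rfl, rfl⟩
  · intro h
    refine ⟨?_, Or.inl h⟩
    rcases h with ⟨u, v, h, rfl, rfl⟩ | ⟨u, v, h, rfl, rfl⟩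
    · exact fun he => h.ne (disp_inl_inj he)
    · exact fun he => h.ne (disp_inr_inj h1 h2 he)

end Display

/-! ### Abstract data of one side of the split -/

structure SideData {K D : Type*} (H : SimpleGraph K) (G : SimpleGraph D) (Φ : K → D) (a1 a2 : D)
    (n1 m1 n2 m2 : K) : Prop where
  inj : Function.Injective Φ
  ne : a1 ≠ a2
  ne1 : ∀ k, Φ k ≠ a1
  ne2 : ∀ k, Φ k ≠ a2
  adj1 : H.Adj n1 m1
  adj2 : H.Adj n2 m2
  fwd : ∀ k k', H.Adj k k' → G.Adj (Φ k) (Φ k') ∨ (k = n1 ∧ k' = m1) ∨ (k = m1 ∧ k' = n1) ∨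
    (k = n2 ∧ k' = m2) ∨ (k = m2 ∧ k' = n2)
  bwd : ∀ k k', G.Adj (Φ k) (Φ k') → H.Adj k k'
  nb1 : ∀ k, G.Adj a1 (Φ k) ↔ k = n1 ∨ k = m1
  nb2 : ∀ k, G.Adj a2 (Φ k) ↔ k = n2 ∨ k = m2
  nadj : ¬ G.Adj a1 a2
  small : (∀ k, ∃ a b, a ≠ b ∧ H.Adj k a ∧ H.Adj k b) ∨
    ((∀ k, k = n1 ∨ k = m1) ∧ ¬ G.Adj (Φ n1) (Φ m1))

/-- Partial decomposition of the subgraph of `G` on `S`, with a bag containing `a1, a2`. -/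
def Half {D : Type*} (G : SimpleGraph D) (S : Set D) (a1 a2 : D) (k : ℕ) : Prop :=
  ∃ (L : TDec D) (i : L.ι), a1 ∈ L.bag i ∧ a2 ∈ L.bag i ∧
    (∀ v, v ∈ S ↔ ∃ j, v ∈ L.bag j) ∧
    (∀ u v, u ∈ S → v ∈ S → G.Adj u v → ∃ j, u ∈ L.bag j ∧ v ∈ L.bag j) ∧
    ∀ j, (L.bag j).ncard ≤ k + 2

section Abs

variable {K D : Type*} {H : SimpleGraph K} {G : SimpleGraph D} {Φ : K → D} {a1 a2 : D}
  {n1 m1 n2 m2 : K}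

lemma SideData.lower [Finite K] [Finite D] (h : SideData H G Φ a1 a2 n1 m1 n2 m2) :
    treewidth H ≤ treewidth G := by
  obtain ⟨E, hE⟩ := exists_isFor (hasTD_treewidth G)
  have key : ∃ F : TDec K, F.IsFor H (treewidth G) := by
   refine hE.minor (H := H)
    (fun k => {v | v = Φ k ∨ (v = a1 ∧ k = n1) ∨ (v = a2 ∧ k = n2)}) Φ
    (fun x => Or.inl rfl) ?_ ?_ ?_
   · rintro x v (rfl | ⟨rfl, rfl⟩ | ⟨rfl, rfl⟩)
     · exact Or.inl rfl
     · exact Or.inr ((h.nb1 x).2 (Or.inl rfl)).symm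
     · exact Or.inr ((h.nb2 x).2 (Or.inl rfl)).symm
   · rintro x y v (rfl | ⟨rfl, rfl⟩ | ⟨rfl, rfl⟩) (h1 | ⟨h1, h2⟩ | ⟨h1, h2⟩)
     · exact h.inj h1
     · exact absurd h1 (h.ne1 _)
     · exact absurd h1 (h.ne2 _)
     · exact absurd h1.symm (h.ne1 _)
     · exact h2.symm
     · exact absurd h1 h.ne
     · exact absurd h1.symm (h.ne2 _)
     · exact absurd h1.symm h.ne
     · exact h2.symm
   · intro x y hxy
     rcases h.fwd x y hxy with h1 | ⟨rfl, rfl⟩ | ⟨rfl, rfl⟩ | ⟨rfl, rfl⟩ | ⟨rfl, rfl⟩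
     · exact ⟨_, Or.inl rfl, _, Or.inl rfl, h1⟩
     · exact ⟨a1, Or.inr (Or.inl ⟨rfl, rfl⟩), _, Or.inl rfl, (h.nb1 _).2 (Or.inr rfl)⟩
     · exact ⟨_, Or.inl rfl, a1, Or.inr (Or.inl ⟨rfl, rfl⟩), ((h.nb1 _).2 (Or.inr rfl)).symm⟩
     · exact ⟨a2, Or.inr (Or.inr ⟨rfl, rfl⟩), _, Or.inl rfl, (h.nb2 _).2 (Or.inr rfl)⟩
     · exact ⟨_, Or.inl rfl, a2, Or.inr (Or.inr ⟨rfl, rfl⟩), ((h.nb2 _).2 (Or.inr rfl)).symm⟩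
  obtain ⟨F, hF⟩ := key
  exact Nat.sInf_le hF.toHas

lemma ncard_three_le {α : Type*} (a b c : α) : ({a, b, c} : Set α).ncard ≤ 3 := by
  have h1 := Set.ncard_insert_le a {b, c}
  have h2 := Set.ncard_insert_le b {c}
  rw [Set.ncard_singleton] at h2
  omega

lemma ncard_four_le {α : Type*} (a b c d : α) : ({a, b, c, d} : Set α).ncard ≤ 4 := by
  have h1 := Set.ncard_insert_le a {b, c, d}
  have h2 := ncard_three_le b c d
  omega

lemma SideData.half [Finite K] [Finite D] (h : SideData H G Φ a1 a2 n1 m1 n2 m2) {k : ℕ}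
    {E : TDec K} (hE : E.IsFor H k) : 1 ≤ k ∧
    Half G {v | v = a1 ∨ v = a2 ∨ ∃ x, v = Φ x} a1 a2 k := by
  have hk : 1 ≤ k := by
    obtain ⟨i, h1, h2⟩ := hE.edge _ _ h.adj1
    have h3 := hE.card i
    have h4 : ({n1, m1} : Set K).ncard ≤ (E.bag i).ncard := by
      apply Set.ncard_le_ncard _ (Set.toFinite _)
      rintro x (rfl | rfl)
      · exact h1
      · exact h2
    rw [Set.ncard_pair h.adj1.ne] at h4
    omega
  refine ⟨hk, ?_⟩
  rcases h.small with hs | ⟨hs, hs'⟩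
  · have : Nonempty K := ⟨n1⟩
    have hk2 := hE.two_le hs
    obtain ⟨i, hi1, hi2⟩ := hE.edge _ _ h.adj2
    let E' : TDec D := ⟨E.ι, E.fin, E.t, E.tree, fun i => insert a1 (Φ '' E.bag i), by
      rintro v i m j hi hj hb
      rcases hi with rfl | ⟨x, hx, rfl⟩
      · exact Or.inl rfl
      · rcases hj with hj | ⟨y, hy, hxy⟩
        · exact absurd hj (h.ne1 _)
        · rw [h.inj hxy] at hy
          exact Or.inr ⟨x, E.conv _ _ _ _ hx hy hb, rfl⟩⟩
    have hE'1 : ∀ j, a1 ∈ E'.bag j := fun j => Or.inl rfl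
    have hE'2 : ∀ x j, x ∈ E.bag j → Φ x ∈ E'.bag j := fun x j hx => Or.inr ⟨x, hx, rfl⟩
    have hE'3 : ∀ v j, v ∈ E'.bag j → v = a1 ∨ ∃ x, x ∈ E.bag j ∧ Φ x = v := fun v j hx => hx
    have hE'4 : ∀ j, (E'.bag j).ncard ≤ k + 2 := by
      intro j
      have h1 := Set.ncard_insert_le a1 (Φ '' E.bag j)
      have h2 := Set.ncard_image_le (f := Φ) (Set.toFinite (E.bag j))
      have h3 := hE.card j
      have : (E'.bag j).ncard = (insert a1 (Φ '' E.bag j)).ncard := rfl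
      omega
    let S : TDec D := TDec.single {Φ n2, Φ m2, a1, a2}
    have hj : ∀ v a b, v ∈ E'.bag a → v ∈ S.bag b → v ∈ E'.bag i ∧ v ∈ S.bag () := by
      intro v a b hv hv'
      refine ⟨?_, hv'⟩
      have hv2 : v = Φ n2 ∨ v = Φ m2 ∨ v = a1 ∨ v = a2 := hv'
      rcases hv2 with rfl | rfl | rfl | rfl
      · exact hE'2 _ _ hi1
      · exact hE'2 _ _ hi2
      · exact hE'1 _
      · rcases hE'3 _ _ hv with h1 | ⟨x, _, h1⟩
        · exact absurd h1.symm h.ne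
        · exact absurd h1 (h.ne2 _)
    have hS : ∀ v, (v = Φ n2 ∨ v = Φ m2 ∨ v = a1 ∨ v = a2) → v ∈ S.bag () := fun v hv => hv
    refine ⟨E'.join S i () hj, Sum.inr (), hS _ (by simp), hS _ (by simp), ?_, ?_, ?_⟩
    · intro v
      constructor
      · rintro (rfl | rfl | ⟨x, rfl⟩)
        · exact ⟨Sum.inr (), hS _ (by simp)⟩
        · exact ⟨Sum.inr (), hS _ (by simp)⟩
        · obtain ⟨j, hj⟩ := hE.cover x
          exact ⟨Sum.inl j, hE'2 _ _ hj⟩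
      · rintro ⟨j | j, hj⟩
        · rcases hE'3 _ _ hj with h1 | ⟨x, _, h1⟩
          · exact Or.inl h1
          · exact Or.inr (Or.inr ⟨x, h1.symm⟩)
        · have hv2 : v = Φ n2 ∨ v = Φ m2 ∨ v = a1 ∨ v = a2 := hj
          rcases hv2 with rfl | rfl | rfl | rfl
          · exact Or.inr (Or.inr ⟨_, rfl⟩)
          · exact Or.inr (Or.inr ⟨_, rfl⟩)
          · exact Or.inl rfl
          · exact Or.inr (Or.inl rfl)
    · have key1 : ∀ v x, v = Φ x → ∃ j, a1 ∈ (E'.join S i () hj).bag j ∧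
          v ∈ (E'.join S i () hj).bag j := by
        rintro v x rfl
        obtain ⟨j, hj⟩ := hE.cover x
        exact ⟨Sum.inl j, hE'1 _, hE'2 _ _ hj⟩
      have key2 : ∀ x, G.Adj a2 (Φ x) → ∃ j, a2 ∈ (E'.join S i () hj).bag j ∧
          Φ x ∈ (E'.join S i () hj).bag j := by
        intro x hx
        refine ⟨Sum.inr (), hS _ (by simp), hS _ ?_⟩
        rcases (h.nb2 x).1 hx with rfl | rfl <;> simp
      rintro u v (rfl | rfl | ⟨x, rfl⟩) (rfl | rfl | ⟨y, rfl⟩) huv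
      · exact absurd rfl huv.ne
      · exact absurd huv h.nadj
      · exact key1 _ y rfl
      · exact absurd huv.symm h.nadj
      · exact absurd rfl huv.ne
      · exact key2 y huv
      · obtain ⟨j, p, q⟩ := key1 _ x rfl
        exact ⟨j, q, p⟩
      · obtain ⟨j, p, q⟩ := key2 x huv.symm
        exact ⟨j, q, p⟩
      · obtain ⟨j, p, q⟩ := hE.edge _ _ (h.bwd _ _ huv)
        exact ⟨Sum.inl j, hE'2 _ _ p, hE'2 _ _ q⟩
    · rintro (j | j)
      · exact hE'4 j
      · have := ncard_four_le (Φ n2) (Φ m2) a1 a2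
        have h2 : ((E'.join S i () hj).bag (Sum.inr j)) = {Φ n2, Φ m2, a1, a2} := rfl
        rw [h2]
        omega
  · let S : TDec D := TDec.single {Φ n1, a1, a2}
    let S' : TDec D := TDec.single {Φ m1, a1, a2}
    have hS : ∀ v, v ∈ S.bag () ↔ (v = Φ n1 ∨ v = a1 ∨ v = a2) := fun v => Iff.rfl
    have hS' : ∀ v, v ∈ S'.bag () ↔ (v = Φ m1 ∨ v = a1 ∨ v = a2) := fun v => Iff.rfl
    have hj : ∀ v a b, v ∈ S.bag a → v ∈ S'.bag b → v ∈ S.bag () ∧ v ∈ S'.bag () :=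
      fun v a b ha hb => ⟨ha, hb⟩
    have e1 : ∀ v, v ∈ (S.join S' () () hj).bag (Sum.inl ()) ↔ (v = Φ n1 ∨ v = a1 ∨ v = a2) :=
      fun v => Iff.rfl
    have e2 : ∀ v, v ∈ (S.join S' () () hj).bag (Sum.inr ()) ↔ (v = Φ m1 ∨ v = a1 ∨ v = a2) :=
      fun v => Iff.rfl
    refine ⟨S.join S' () () hj, Sum.inr (), (e2 _).2 (by simp), (e2 _).2 (by simp), ?_, ?_, ?_⟩
    · intro v
      constructor
      · rintro (rfl | rfl | ⟨x, rfl⟩)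
        · exact ⟨Sum.inr (), (e2 _).2 (by simp)⟩
        · exact ⟨Sum.inr (), (e2 _).2 (by simp)⟩
        · rcases hs x with rfl | rfl
          · exact ⟨Sum.inl (), (e1 _).2 (by simp)⟩
          · exact ⟨Sum.inr (), (e2 _).2 (by simp)⟩
      · rintro ⟨j | j, hj⟩
        · rcases (e1 _).1 hj with rfl | rfl | rfl
          · exact Or.inr (Or.inr ⟨_, rfl⟩)
          · exact Or.inl rfl
          · exact Or.inr (Or.inl rfl)
        · rcases (e2 _).1 hj with rfl | rfl | rfl
          · exact Or.inr (Or.inr ⟨_, rfl⟩)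
          · exact Or.inl rfl
          · exact Or.inr (Or.inl rfl)
    · have key : ∀ x v, v = a1 ∨ v = a2 → ∃ j, v ∈ (S.join S' () () hj).bag j ∧
          Φ x ∈ (S.join S' () () hj).bag j := by
        intro x v hv
        rcases hs x with rfl | rfl
        · exact ⟨Sum.inl (), (e1 _).2 (Or.inr hv), (e1 _).2 (by simp)⟩
        · exact ⟨Sum.inr (), (e2 _).2 (Or.inr hv), (e2 _).2 (by simp)⟩
      rintro u v (rfl | rfl | ⟨x, rfl⟩) (rfl | rfl | ⟨y, rfl⟩) huv
      · exact absurd rfl huv.ne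
      · exact absurd huv h.nadj
      · exact key y _ (by simp)
      · exact absurd huv.symm h.nadj
      · exact absurd rfl huv.ne
      · exact key y _ (by simp)
      · obtain ⟨j, p, q⟩ := key x v (by simp)
        exact ⟨j, q, p⟩
      · obtain ⟨j, p, q⟩ := key x v (by simp)
        exact ⟨j, q, p⟩
      · rcases hs x with rfl | rfl <;> rcases hs y with rfl | rfl
        · exact absurd rfl huv.ne
        · exact absurd huv hs'
        · exact absurd huv.symm hs'
        · exact absurd rfl huv.ne
    · rintro (j | j)
      · have := ncard_three_le (Φ n1) a1 a2
        have h2 : ((S.join S' () () hj).bag (Sum.inl j)) = {Φ n1, a1, a2} := rfl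
        rw [h2]
        omega
      · have := ncard_three_le (Φ m1) a1 a2
        have h2 : ((S.join S' () () hj).bag (Sum.inr j)) = {Φ m1, a1, a2} := rfl
        rw [h2]
        omega

lemma Half.mono {S : Set D} {k k' : ℕ} (h : Half G S a1 a2 k) (hk : k ≤ k') :
    Half G S a1 a2 k' := by
  obtain ⟨L, i, h1, h2, h3, h4, h5⟩ := h
  exact ⟨L, i, h1, h2, h3, h4, fun j => (h5 j).trans (by omega)⟩

lemma Half.glue {S S' : Set D} {b1 b2 : D} {k : ℕ} (h : Half G S a1 a2 k)
    (h' : Half G S' b1 b2 k) (hk : 1 ≤ k) (hd : ∀ v, v ∈ S → v ∉ S') (hc : ∀ v, v ∈ S ∨ v ∈ S')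
    (he : ∀ u v, u ∈ S → v ∈ S' → G.Adj u v → (u = a1 ∧ v = b1) ∨ (u = a2 ∧ v = b2)) :
    ∃ E : TDec D, E.IsFor G (k + 1) := by
  obtain ⟨L, i, ha1, ha2, hS, hSe, hL⟩ := h
  obtain ⟨R, i', hb1, hb2, hS', hSe', hR⟩ := h'
  have ma1 : a1 ∈ S := (hS _).2 ⟨_, ha1⟩
  have ma2 : a2 ∈ S := (hS _).2 ⟨_, ha2⟩
  have mb1 : b1 ∈ S' := (hS' _).2 ⟨_, hb1⟩
  have mb2 : b2 ∈ S' := (hS' _).2 ⟨_, hb2⟩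
  let M : TDec D := TDec.single {a1, a2, b1}
  let N : TDec D := TDec.single {a2, b1, b2}
  have hM : ∀ v j, v ∈ M.bag j ↔ v = a1 ∨ v = a2 ∨ v = b1 := fun v j => Iff.rfl
  have hN : ∀ v j, v ∈ N.bag j ↔ v = a2 ∨ v = b1 ∨ v = b2 := fun v j => Iff.rfl
  have j1 : ∀ v a b, v ∈ L.bag a → v ∈ M.bag b → v ∈ L.bag i ∧ v ∈ M.bag () := by
    intro v a b hva hvb
    refine ⟨?_, hvb⟩
    rcases (hM _ _).1 hvb with rfl | rfl | rfl
    · exact ha1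
    · exact ha2
    · exact absurd mb1 (hd _ ((hS _).2 ⟨_, hva⟩))
  have j2 : ∀ v a b, v ∈ N.bag a → v ∈ R.bag b → v ∈ N.bag () ∧ v ∈ R.bag i' := by
    intro v a b hva hvb
    refine ⟨hva, ?_⟩
    rcases (hN _ _).1 hva with rfl | rfl | rfl
    · exact absurd ((hS' _).2 ⟨_, hvb⟩) (hd _ ma2)
    · exact hb1
    · exact hb2
  let P := L.join M i () j1
  let Q := N.join R () i' j2
  have j3 : ∀ v a b, v ∈ P.bag a → v ∈ Q.bag b → v ∈ P.bag (Sum.inr ()) ∧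
      v ∈ Q.bag (Sum.inl ()) := by
    intro v a b hva hvb
    have hP : ∀ x, x ∈ P.bag (Sum.inr ()) ↔ x = a1 ∨ x = a2 ∨ x = b1 := fun x => Iff.rfl
    have hQ : ∀ x, x ∈ Q.bag (Sum.inl ()) ↔ x = a2 ∨ x = b1 ∨ x = b2 := fun x => Iff.rfl
    have c1 : v ∈ S ∨ v = b1 := by
      rcases a with a | a
      · exact Or.inl ((hS _).2 ⟨_, hva⟩)
      · rcases (hP v).1 hva with rfl | rfl | rfl
        · exact Or.inl ma1
        · exact Or.inl ma2
        · exact Or.inr rfl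
    have c2 : v ∈ S' ∨ v = a2 := by
      rcases b with b | b
      · rcases (hQ v).1 hvb with rfl | rfl | rfl
        · exact Or.inr rfl
        · exact Or.inl mb1
        · exact Or.inl mb2
      · exact Or.inl ((hS' _).2 ⟨_, hvb⟩)
    rcases c1 with c1 | rfl
    · rcases c2 with c2 | rfl
      · exact absurd c2 (hd _ c1)
      · exact ⟨(hP _).2 (by simp), (hQ _).2 (by simp)⟩
    · exact ⟨(hP _).2 (by simp), (hQ _).2 (by simp)⟩
  let F := P.join Q (Sum.inr ()) (Sum.inl ()) j3
  have f1 : ∀ v j, v ∈ L.bag j → v ∈ F.bag (Sum.inl (Sum.inl j)) := fun v j h => h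
  have f2 : ∀ v j, v ∈ R.bag j → v ∈ F.bag (Sum.inr (Sum.inr j)) := fun v j h => h
  have f3 : ∀ v, v = a1 ∨ v = a2 ∨ v = b1 → v ∈ F.bag (Sum.inl (Sum.inr ())) := fun v h => h
  have f4 : ∀ v, v = a2 ∨ v = b1 ∨ v = b2 → v ∈ F.bag (Sum.inr (Sum.inl ())) := fun v h => h
  have cross : ∀ u v, u ∈ S → v ∈ S' → G.Adj u v → ∃ j, u ∈ F.bag j ∧ v ∈ F.bag j := by
    intro u v hu hv huv
    rcases he u v hu hv huv with ⟨rfl, rfl⟩ | ⟨rfl, rfl⟩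
    · exact ⟨_, f3 _ (by simp), f3 _ (by simp)⟩
    · exact ⟨_, f4 _ (by simp), f4 _ (by simp)⟩
  refine ⟨F, ?_, ?_, ?_⟩
  · intro v
    rcases hc v with hv | hv
    · obtain ⟨j, hj⟩ := (hS v).1 hv
      exact ⟨_, f1 _ _ hj⟩
    · obtain ⟨j, hj⟩ := (hS' v).1 hv
      exact ⟨_, f2 _ _ hj⟩
  · intro u v huv
    rcases hc u with hu | hu <;> rcases hc v with hv | hv
    · obtain ⟨j, p, q⟩ := hSe _ _ hu hv huv
      exact ⟨_, f1 _ _ p, f1 _ _ q⟩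
    · exact cross u v hu hv huv
    · obtain ⟨j, p, q⟩ := cross v u hv hu huv.symm
      exact ⟨j, q, p⟩
    · obtain ⟨j, p, q⟩ := hSe' _ _ hu hv huv
      exact ⟨_, f2 _ _ p, f2 _ _ q⟩
  · rintro ((j | j) | (j | j))
    · exact hL j
    · have h1 := ncard_three_le a1 a2 b1
      exact h1.trans (by omega)
    · have h1 := ncard_three_le a2 b1 b2
      exact h1.trans (by omega)
    · exact hR j

end Abs

/-! ### Building the side data -/

namespace PhyloTree

lemma Side.pre {V X W : Type*} {T : PhyloTree V X} {Y : Set X} {u v : V}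
    {R : PhyloTree W {x : X // x ∈ Y}} {φ : W → V} {n m : V} (h : T.Side Y u v R φ n m)
    (huv : T.graph.Adj u v) : (∃ w, φ w = n) ∧ ∃ w, φ w = m := by
  have aux : ∀ z, T.graph.Adj u z → z ≠ v → ∃ w, φ w = z := by
    intro z hz hzv
    rcases side_nbr huv (btw_left u v) hz with h1 | ⟨_, h1⟩
    · exact h.surj z h1 hz.ne'
    · exact absurd h1 hzv
  exact ⟨aux n ((h.nbr n).2 (by simp)) h.hne1, aux m ((h.nbr m).2 (by simp)) h.hne2⟩

lemma Side.ne_v {V X W : Type*} {T : PhyloTree V X} {Y : Set X} {u v : V}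
    {R : PhyloTree W {x : X // x ∈ Y}} {φ : W → V} {n m : V} (h : T.Side Y u v R φ n m)
    (huv : T.graph.Adj u v) (w : W) : φ w ≠ v := by
  intro hw
  have := h.mem w
  rw [hw] at this
  exact huv.ne (btw_self this)

lemma Side.two_leaves {V X W : Type*} {T : PhyloTree V X} {Y : Set X} {u v : V}
    {R : PhyloTree W {x : X // x ∈ Y}} {φ : W → V} {n m : V} (h : T.Side Y u v R φ n m)
    (huv : T.graph.Adj u v) {y z : {x : X // x ∈ Y}}
    (hyz : R.graph.Adj (R.leaf y) (R.leaf z)) :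
    (∀ w, w = R.leaf y ∨ w = R.leaf z) ∧ ¬ T.graph.Adj (T.leaf y.1) (T.leaf z.1) := by
  have h1 : ∀ w, w = R.leaf y ∨ w = R.leaf z := by
    intro w
    by_cases hw : w = R.leaf y
    · exact Or.inl hw
    · right
      obtain ⟨s, hs, hb⟩ := exists_first_step R.connected R.acyclic hw
      obtain ⟨q, hq⟩ := R.leaf_nbr y
      rw [(hq s).1 hs, ← (hq _).1 hyz] at hb
      rcases R.leaf_btw hb with h | h
      · exact absurd h hyz.ne'
      · exact h.symm
  refine ⟨h1, fun ha => ?_⟩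
  obtain ⟨⟨w, hw⟩, _⟩ := h.pre huv
  have hun : T.graph.Adj u n := (h.nbr n).2 (by simp)
  rw [← hw] at hun
  rcases h1 w with rfl | rfl
  · rw [h.leaf] at hun
    obtain ⟨q, hq⟩ := T.leaf_nbr y.1
    exact h.leaf_ne z.1 (((hq _).1 ha).trans ((hq _).1 hun.symm).symm)
  · rw [h.leaf] at hun
    obtain ⟨q, hq⟩ := T.leaf_nbr z.1
    exact h.leaf_ne y.1 (((hq _).1 ha.symm).trans ((hq _).1 hun.symm).symm)

lemma Side.leaf_pre {V X W : Type*} {T : PhyloTree V X} {Y : Set X} {u v : V}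
    {R : PhyloTree W {x : X // x ∈ Y}} {φ : W → V} {n m : V} (h : T.Side Y u v R φ n m)
    (hY : ∀ x, x ∈ Y ↔ GBtw T.graph (T.leaf x) u v) {x : X} {w : W} (hx : T.leaf x = φ w) :
    ∃ hx : x ∈ Y, w = R.leaf ⟨x, hx⟩ := by
  have hxY : x ∈ Y := by
    rw [hY, hx]
    exact h.mem w
  exact ⟨hxY, h.inj (by rw [h.leaf, hx])⟩

end PhyloTree

section Build

variable {V1 V2 X W1 W2 : Type*} {T1 : PhyloTree V1 X} {T2 : PhyloTree V2 X} {Y : Set X}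
  {u1 v1 : V1} {u2 v2 : V2} {R1 : PhyloTree W1 {x : X // x ∈ Y}}
  {R2 : PhyloTree W2 {x : X // x ∈ Y}} {φ1 : W1 → V1} {φ2 : W2 → V2} {n1 m1 : V1} {n2 m2 : V2}

lemma exists_sideData (s1 : T1.Side Y u1 v1 R1 φ1 n1 m1) (s2 : T2.Side Y u2 v2 R2 φ2 n2 m2)
    (h1 : T1.graph.Adj u1 v1) (h2 : T2.graph.Adj u2 v2)
    (hY1 : ∀ x, x ∈ Y ↔ GBtw T1.graph (T1.leaf x) u1 v1)
    (hY2 : ∀ x, x ∈ Y ↔ GBtw T2.graph (T2.leaf x) u2 v2) :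
    ∃ Φ N1 M1 N2 M2, SideData (displayGraph R1.graph R1.leaf R2.graph R2.leaf)
      (displayGraph T1.graph T1.leaf T2.graph T2.leaf) Φ
      (toDisplay T1.leaf T2.leaf (Sum.inl u1)) (toDisplay T1.leaf T2.leaf (Sum.inr u2))
      N1 M1 N2 M2 ∧
      (∀ z, toDisplay T1.leaf T2.leaf (Sum.inl z) ∈
        {v | v = toDisplay T1.leaf T2.leaf (Sum.inl u1) ∨
          v = toDisplay T1.leaf T2.leaf (Sum.inr u2) ∨ ∃ x, v = Φ x} ↔ GBtw T1.graph z u1 v1) ∧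
      (∀ z, toDisplay T1.leaf T2.leaf (Sum.inr z) ∈
        {v | v = toDisplay T1.leaf T2.leaf (Sum.inl u1) ∨
          v = toDisplay T1.leaf T2.leaf (Sum.inr u2) ∨ ∃ x, v = Φ x} ↔
            GBtw T2.graph z u2 v2) := by
  classical
  let e1 : W1 → DisplayVertex R1.leaf R2.leaf := fun w => toDisplay R1.leaf R2.leaf (Sum.inl w)
  let e2 : W2 → DisplayVertex R1.leaf R2.leaf := fun w => toDisplay R1.leaf R2.leaf (Sum.inr w)
  let d1 : V1 → DisplayVertex T1.leaf T2.leaf := fun w => toDisplay T1.leaf T2.leaf (Sum.inl w)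
  let d2 : V2 → DisplayVertex T1.leaf T2.leaf := fun w => toDisplay T1.leaf T2.leaf (Sum.inr w)
  have d1i : Function.Injective d1 := disp_inl_inj
  have d2i : Function.Injective d2 := disp_inr_inj T1.leaf_inj T2.leaf_inj
  have d12 : ∀ v w, d1 v = d2 w → ∃ x, T1.leaf x = v ∧ T2.leaf x = w :=
    fun v w h => (disp_inl_eq_inr T2.leaf_inj).1 h
  have e12 : ∀ v w, e1 v = e2 w → ∃ x, R1.leaf x = v ∧ R2.leaf x = w :=
    fun v w h => (disp_inl_eq_inr R2.leaf_inj).1 h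
  have dl : ∀ x, d2 (T2.leaf x) = d1 (T1.leaf x) := fun x => disp_leaf T2.leaf_inj x
  have el : ∀ x, e2 (R2.leaf x) = e1 (R1.leaf x) := fun x => disp_leaf R2.leaf_inj x
  have ec : ∀ k, (∃ w, k = e1 w) ∨ ∃ w, (∀ x, R2.leaf x ≠ w) ∧ k = e2 w := fun k => disp_cases k
  have gadj : ∀ a b, (displayGraph T1.graph T1.leaf T2.graph T2.leaf).Adj a b ↔
      (∃ u v, T1.graph.Adj u v ∧ a = d1 u ∧ b = d1 v) ∨
      (∃ u v, T2.graph.Adj u v ∧ a = d2 u ∧ b = d2 v) :=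
    fun a b => disp_adj T1.leaf_inj T2.leaf_inj
  have hadj : ∀ a b, (displayGraph R1.graph R1.leaf R2.graph R2.leaf).Adj a b ↔
      (∃ u v, R1.graph.Adj u v ∧ a = e1 u ∧ b = e1 v) ∨
      (∃ u v, R2.graph.Adj u v ∧ a = e2 u ∧ b = e2 v) :=
    fun a b => disp_adj R1.leaf_inj R2.leaf_inj
  let Φ : DisplayVertex R1.leaf R2.leaf → DisplayVertex T1.leaf T2.leaf :=
    fun a => toDisplay T1.leaf T2.leaf (Sum.map φ1 φ2 a.1)
  have Φ1 : ∀ w, Φ (e1 w) = d1 (φ1 w) := fun w => rfl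
  have Φ2 : ∀ w, Φ (e2 w) = d2 (φ2 w) := by
    intro w
    by_cases hw : ∃ y, R2.leaf y = w
    · obtain ⟨y, rfl⟩ := hw
      rw [el, Φ1, s1.leaf, s2.leaf, dl]
    · have : (e2 w).1 = Sum.inr w := disp_inr_val (by simpa using hw)
      show toDisplay T1.leaf T2.leaf (Sum.map φ1 φ2 (e2 w).1) = _
      rw [this]
      rfl
  have lift1 : ∀ k z, Φ k = d1 z → ∃ w, k = e1 w ∧ φ1 w = z := by
    intro k z hk
    rcases ec k with ⟨w, rfl⟩ | ⟨w, -, rfl⟩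
    · exact ⟨w, rfl, d1i hk⟩
    · rw [Φ2] at hk
      obtain ⟨x, rfl, hx⟩ := d12 _ _ hk.symm
      obtain ⟨hxY, rfl⟩ := s2.leaf_pre hY2 hx
      exact ⟨_, el _, s1.leaf _⟩
  have lift2 : ∀ k z, Φ k = d2 z → ∃ w, k = e2 w ∧ φ2 w = z := by
    intro k z hk
    rcases ec k with ⟨w, rfl⟩ | ⟨w, -, rfl⟩
    · rw [Φ1] at hk
      obtain ⟨x, hx, rfl⟩ := d12 _ _ hk
      obtain ⟨hxY, rfl⟩ := s1.leaf_pre hY1 hx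
      exact ⟨_, (el _).symm, s2.leaf _⟩
    · rw [Φ2] at hk
      exact ⟨w, rfl, d2i hk⟩
  have u12 : ∀ z, d1 u1 ≠ d2 z := by
    intro z hz
    obtain ⟨x, hx, _⟩ := d12 _ _ hz
    exact s1.leaf_ne x hx
  have u21 : ∀ z, d1 z ≠ d2 u2 := by
    intro z hz
    obtain ⟨x, _, hx⟩ := d12 _ _ hz
    exact s2.leaf_ne x hx
  have hne1 : ∀ k, Φ k ≠ d1 u1 := by
    intro k hk
    obtain ⟨w, _, hw⟩ := lift1 _ _ hk
    exact s1.ne w hw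
  have hne2 : ∀ k, Φ k ≠ d2 u2 := by
    intro k hk
    obtain ⟨w, _, hw⟩ := lift2 _ _ hk
    exact s2.ne w hw
  obtain ⟨⟨p1, hp1⟩, ⟨q1, hq1⟩⟩ := s1.pre h1
  obtain ⟨⟨p2, hp2⟩, ⟨q2, hq2⟩⟩ := s2.pre h2
  have a1 : (displayGraph R1.graph R1.leaf R2.graph R2.leaf).Adj (e1 p1) (e1 q1) :=
    (hadj _ _).2 (Or.inl ⟨_, _, (s1.adj _ _).2 (Or.inr (Or.inl ⟨hp1, hq1⟩)), rfl, rfl⟩)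
  have a2 : (displayGraph R1.graph R1.leaf R2.graph R2.leaf).Adj (e2 p2) (e2 q2) :=
    (hadj _ _).2 (Or.inr ⟨_, _, (s2.adj _ _).2 (Or.inr (Or.inl ⟨hp2, hq2⟩)), rfl, rfl⟩)
  refine ⟨Φ, e1 p1, e1 q1, e2 p2, e2 q2, ⟨?_, u12 _, hne1, hne2, a1, a2, ?_, ?_, ?_, ?_, ?_, ?_⟩,
    ?_, ?_⟩
  · intro k k' hk
    rcases ec k with ⟨w, rfl⟩ | ⟨w, -, rfl⟩
    · rw [Φ1] at hk
      obtain ⟨w', rfl, hw⟩ := lift1 _ _ hk.symm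
      rw [s1.inj hw]
    · rw [Φ2] at hk
      obtain ⟨w', rfl, hw⟩ := lift2 _ _ hk.symm
      rw [s2.inj hw]
  · intro k k' hk
    rcases (hadj _ _).1 hk with ⟨w, w', hw, rfl, rfl⟩ | ⟨w, w', hw, rfl, rfl⟩
    · rw [Φ1, Φ1]
      rcases (s1.adj _ _).1 hw with h | ⟨ha, hb⟩ | ⟨ha, hb⟩
      · exact Or.inl ((gadj _ _).2 (Or.inl ⟨_, _, h, rfl, rfl⟩))
      · rw [← hp1] at ha
        rw [← hq1] at hb
        rw [s1.inj ha, s1.inj hb]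
        simp
      · rw [← hq1] at ha
        rw [← hp1] at hb
        rw [s1.inj ha, s1.inj hb]
        simp
    · rw [Φ2, Φ2]
      rcases (s2.adj _ _).1 hw with h | ⟨ha, hb⟩ | ⟨ha, hb⟩
      · exact Or.inl ((gadj _ _).2 (Or.inr ⟨_, _, h, rfl, rfl⟩))
      · rw [← hp2] at ha
        rw [← hq2] at hb
        rw [s2.inj ha, s2.inj hb]
        simp
      · rw [← hq2] at ha
        rw [← hp2] at hb
        rw [s2.inj ha, s2.inj hb]
        simp
  · intro k k' hk
    rcases (gadj _ _).1 hk with ⟨w, w', hw, ha, hb⟩ | ⟨w, w', hw, ha, hb⟩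
    · obtain ⟨x, rfl, rfl⟩ := lift1 _ _ ha
      obtain ⟨y, rfl, rfl⟩ := lift1 _ _ hb
      exact (hadj _ _).2 (Or.inl ⟨_, _, (s1.adj _ _).2 (Or.inl hw), rfl, rfl⟩)
    · obtain ⟨x, rfl, rfl⟩ := lift2 _ _ ha
      obtain ⟨y, rfl, rfl⟩ := lift2 _ _ hb
      exact (hadj _ _).2 (Or.inr ⟨_, _, (s2.adj _ _).2 (Or.inl hw), rfl, rfl⟩)
  · intro k
    constructor
    · intro hk
      rcases (gadj _ _).1 hk with ⟨w, w', hw, ha, hb⟩ | ⟨w, w', hw, ha, hb⟩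
      · have := d1i ha
        subst this
        obtain ⟨x, rfl, rfl⟩ := lift1 _ _ hb
        rcases (s1.nbr _).1 hw with h | h | h
        · exact absurd h (s1.ne_v h1 x)
        · rw [← hp1] at h
          exact Or.inl (by rw [s1.inj h])
        · rw [← hq1] at h
          exact Or.inr (by rw [s1.inj h])
      · exact absurd ha (u12 _)
    · rintro (rfl | rfl)
      · exact (gadj _ _).2 (Or.inl ⟨u1, n1, (s1.nbr _).2 (by simp), rfl, by rw [Φ1, hp1]⟩)
      · exact (gadj _ _).2 (Or.inl ⟨u1, m1, (s1.nbr _).2 (by simp), rfl, by rw [Φ1, hq1]⟩)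
  · intro k
    constructor
    · intro hk
      rcases (gadj _ _).1 hk with ⟨w, w', hw, ha, hb⟩ | ⟨w, w', hw, ha, hb⟩
      · exact absurd ha.symm (u21 _)
      · have := d2i ha
        subst this
        obtain ⟨x, rfl, rfl⟩ := lift2 _ _ hb
        rcases (s2.nbr _).1 hw with h | h | h
        · exact absurd h (s2.ne_v h2 x)
        · rw [← hp2] at h
          exact Or.inl (by rw [s2.inj h])
        · rw [← hq2] at h
          exact Or.inr (by rw [s2.inj h])
    · rintro (rfl | rfl)
      · exact (gadj _ _).2 (Or.inr ⟨u2, n2, (s2.nbr _).2 (by simp), rfl, by rw [Φ2, hp2]⟩)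
      · exact (gadj _ _).2 (Or.inr ⟨u2, m2, (s2.nbr _).2 (by simp), rfl, by rw [Φ2, hq2]⟩)
  · intro hk
    rcases (gadj _ _).1 hk with ⟨w, w', hw, ha, hb⟩ | ⟨w, w', hw, ha, hb⟩
    · exact u21 _ hb.symm
    · exact u12 _ ha
  · by_cases hyz : ∃ y z, R1.graph.Adj (R1.leaf y) (R1.leaf z) ∧
        R2.graph.Adj (R2.leaf y) (R2.leaf z)
    · right
      obtain ⟨y, z, r1, r2⟩ := hyz
      obtain ⟨c1, t1⟩ := s1.two_leaves h1 r1
      obtain ⟨c2, t2⟩ := s2.two_leaves h2 r2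
      have hK : ∀ k, k = e1 (R1.leaf y) ∨ k = e1 (R1.leaf z) := by
        intro k
        rcases ec k with ⟨w, rfl⟩ | ⟨w, hw, rfl⟩
        · rcases c1 w with rfl | rfl <;> simp
        · rcases c2 w with rfl | rfl
          · exact absurd rfl (hw y)
          · exact absurd rfl (hw z)
      have hno : ¬ (displayGraph T1.graph T1.leaf T2.graph T2.leaf).Adj
          (Φ (e1 (R1.leaf y))) (Φ (e1 (R1.leaf z))) := by
        intro hk
        rcases (gadj _ _).1 hk with ⟨w, w', hw, ha, hb⟩ | ⟨w, w', hw, ha, hb⟩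
        · rw [Φ1, s1.leaf] at ha hb
          rw [← d1i ha, ← d1i hb] at hw
          exact t1 hw
        · rw [Φ1, s1.leaf, ← dl] at ha hb
          rw [← d2i ha, ← d2i hb] at hw
          exact t2 hw
      have hne := a1.ne
      rcases hK (e1 p1) with hp | hp <;> rcases hK (e1 q1) with hq | hq
      · exact absurd (hp.trans hq.symm) hne
      · rw [hp, hq]
        exact ⟨hK, hno⟩
      · rw [hp, hq]
        exact ⟨fun k => (hK k).symm, fun h => hno h.symm⟩
      · exact absurd (hp.trans hq.symm) hne
    · left
      have e1i : Function.Injective e1 := disp_inl_inj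
      have e2i : Function.Injective e2 := disp_inr_inj R1.leaf_inj R2.leaf_inj
      intro k
      rcases ec k with ⟨w, rfl⟩ | ⟨w, hw, rfl⟩
      · by_cases hw : ∃ y, R1.leaf y = w
        · obtain ⟨y, rfl⟩ := hw
          obtain ⟨p, hp⟩ := R1.leaf_nbr y
          obtain ⟨q, hq⟩ := R2.leaf_nbr y
          refine ⟨e1 p, e2 q, ?_, (hadj _ _).2 (Or.inl ⟨_, _, (hp p).2 rfl, rfl, rfl⟩),
            (hadj _ _).2 (Or.inr ⟨_, _, (hq q).2 rfl, (el y).symm, rfl⟩)⟩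
          intro hpq
          obtain ⟨z, rfl, rfl⟩ := e12 _ _ hpq
          exact hyz ⟨y, z, (hp _).2 rfl, (hq _).2 rfl⟩
        · obtain ⟨a, b, c, hab, -, -, hn⟩ := R1.internal_nbr w (by simpa using hw)
          exact ⟨e1 a, e1 b, fun h => hab (e1i h),
            (hadj _ _).2 (Or.inl ⟨_, _, (hn a).2 (by simp), rfl, rfl⟩),
            (hadj _ _).2 (Or.inl ⟨_, _, (hn b).2 (by simp), rfl, rfl⟩)⟩
      · obtain ⟨a, b, c, hab, -, -, hn⟩ := R2.internal_nbr w hw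
        exact ⟨e2 a, e2 b, fun h => hab (e2i h),
          (hadj _ _).2 (Or.inr ⟨_, _, (hn a).2 (by simp), rfl, rfl⟩),
          (hadj _ _).2 (Or.inr ⟨_, _, (hn b).2 (by simp), rfl, rfl⟩)⟩
  · intro z
    constructor
    · rintro (h | h | ⟨x, h⟩)
      · rw [d1i h]
        exact btw_left _ _
      · exact absurd h (u21 _)
      · obtain ⟨w, _, rfl⟩ := lift1 _ _ h.symm
        exact s1.mem w
    · intro h
      by_cases hz : z = u1
      · exact Or.inl (by rw [hz])
      · obtain ⟨w, rfl⟩ := s1.surj z h hz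
        exact Or.inr (Or.inr ⟨e1 w, rfl⟩)
  · intro z
    constructor
    · rintro (h | h | ⟨x, h⟩)
      · exact absurd h.symm (u12 _)
      · rw [d2i h]
        exact btw_left _ _
      · obtain ⟨w, _, rfl⟩ := lift2 _ _ h.symm
        exact s2.mem w
    · intro h
      by_cases hz : z = u2
      · exact Or.inr (Or.inl (by rw [hz]))
      · obtain ⟨w, rfl⟩ := s2.surj z h hz
        exact Or.inr (Or.inr ⟨e2 w, (Φ2 w).symm⟩)

end Build

lemma SplitAt.symm {V X : Type*} {T : PhyloTree V X} {A B : Set X} {a b : V}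
    (h : SplitAt T A B a b) : SplitAt T B A b a := by
  obtain ⟨h1, h2, h3⟩ := h
  refine ⟨h1.symm, ?_, ?_⟩
  · rw [Sym2.eq_swap]
    exact h3
  · rw [Sym2.eq_swap]
    exact h2

lemma SplitAt.btw {V X : Type*} {T : PhyloTree V X} {A B : Set X} {a b : V}
    (h : SplitAt T A B a b) {x : X} (hx : x ∈ A) : GBtw T.graph (T.leaf x) a b := by
  classical
  intro w
  by_contra ha
  have hr := h.2.1 x hx
  have hbr : ¬ (T.graph.deleteEdges {s(a, b)}).Reachable a b := by
    have := (isAcyclic_iff_forall_adj_isBridge.1 T.acyclic) h.1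
    exact (isBridge_iff.1 this)
  apply hbr
  refine hr.trans ⟨w.toDeleteEdges {s(a, b)} ?_⟩
  rintro e he rfl
  exact ha (w.fst_mem_support_of_mem_edges he)

lemma SplitAt.mem_iff {V X : Type*} {T : PhyloTree V X} {A B : Set X} {a b : V}
    (h : SplitAt T A B a b) (hc : A ∪ B = Set.univ) (x : X) :
    x ∈ A ↔ GBtw T.graph (T.leaf x) a b := by
  refine ⟨h.btw, fun hb => ?_⟩
  by_contra hx
  have hB : x ∈ B := by
    have : x ∈ A ∪ B := hc ▸ Set.mem_univ x
    exact this.resolve_left hx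
  exact h.1.ne (hb.antisymm T.connected (h.symm.btw hB)).symm

/-- Cluster reduction bound: if the incompatible trees `T1, T2` have a common
split `X* | X**`, and `p`, `q` are the treewidths of the display graphs of the
restrictions of the trees to `X*` and to `X**` respectively, then
`max(p,q) ≤ tw(D(T1,T2)) ≤ max(p,q) + 1`. -/
theorem treewidth_cluster_reduction {V1 V2 X W1 W2 W3 W4 : Type*}
    (T1 : PhyloTree V1 X) (T2 : PhyloTree V2 X)
    (hinc : ¬ Compatible T1 T2)
    (Xs Xss : Set X) (hne1 : Xs.Nonempty) (hne2 : Xss.Nonempty)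
    (hcover : Xs ∪ Xss = Set.univ) (hdisj : Xs ∩ Xss = ∅)
    (u1 v1 : V1) (u2 v2 : V2)
    (hs1 : SplitAt T1 Xs Xss u1 v1) (hs2 : SplitAt T2 Xs Xss u2 v2)
    (R1 : PhyloTree W1 {x : X // x ∈ Xs}) (R2 : PhyloTree W2 {x : X // x ∈ Xs})
    (hR1 : IsRestriction T1 Xs R1) (hR2 : IsRestriction T2 Xs R2)
    (S1 : PhyloTree W3 {x : X // x ∈ Xss}) (S2 : PhyloTree W4 {x : X // x ∈ Xss})
    (hS1 : IsRestriction T1 Xss S1) (hS2 : IsRestriction T2 Xss S2) :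
    max (treewidth (displayGraph R1.graph R1.leaf R2.graph R2.leaf))
        (treewidth (displayGraph S1.graph S1.leaf S2.graph S2.leaf)) ≤
      treewidth (displayGraph T1.graph T1.leaf T2.graph T2.leaf) ∧
    treewidth (displayGraph T1.graph T1.leaf T2.graph T2.leaf) ≤
      max (treewidth (displayGraph R1.graph R1.leaf R2.graph R2.leaf))
          (treewidth (displayGraph S1.graph S1.leaf S2.graph S2.leaf)) + 1 := by
  have := T1.finite
  have := T2.finite
  have := R1.finite
  have := R2.finite
  have := S1.finite
  have := S2.finite
  have fT : Finite (DisplayVertex T1.leaf T2.leaf) := disp_finite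
  have fR : Finite (DisplayVertex R1.leaf R2.leaf) := disp_finite
  have fS : Finite (DisplayVertex S1.leaf S2.leaf) := disp_finite
  have hcover' : Xss ∪ Xs = Set.univ := by rw [Set.union_comm, hcover]
  obtain ⟨φ1, n1, m1, r1⟩ := PhyloTree.exists_side hs1.1 (hs1.mem_iff hcover) R1 hR1
  obtain ⟨φ2, n2, m2, r2⟩ := PhyloTree.exists_side hs2.1 (hs2.mem_iff hcover) R2 hR2
  obtain ⟨ψ1, k1, l1, t1⟩ := PhyloTree.exists_side hs1.1.symm (hs1.symm.mem_iff hcover') S1 hS1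
  obtain ⟨ψ2, k2, l2, t2⟩ := PhyloTree.exists_side hs2.1.symm (hs2.symm.mem_iff hcover') S2 hS2
  obtain ⟨Φ, N1, M1, N2, M2, hΦ, hA1, hA2⟩ := exists_sideData r1 r2 hs1.1 hs2.1
    (hs1.mem_iff hcover) (hs2.mem_iff hcover)
  obtain ⟨Ψ, K1, L1, K2, L2, hΨ, hB1, hB2⟩ := exists_sideData t1 t2 hs1.1.symm hs2.1.symm
    (hs1.symm.mem_iff hcover') (hs2.symm.mem_iff hcover')
  refine ⟨max_le hΦ.lower hΨ.lower, ?_⟩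
  obtain ⟨E, hE⟩ := exists_isFor
    (hasTD_treewidth (displayGraph R1.graph R1.leaf R2.graph R2.leaf))
  obtain ⟨F, hF⟩ := exists_isFor
    (hasTD_treewidth (displayGraph S1.graph S1.leaf S2.graph S2.leaf))
  obtain ⟨hk, hL⟩ := hΦ.half hE
  obtain ⟨-, hR⟩ := hΨ.half hF
  obtain ⟨Z, hZ⟩ := (hL.mono (le_max_left _ _)).glue (hR.mono (le_max_right _ _))
    (hk.trans (le_max_left _ _))
    (by
      intro v hv hv'
      rcases disp_cases v with ⟨z, rfl⟩ | ⟨z, -, rfl⟩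
      · exact hs1.1.ne (((hA1 z).1 hv).antisymm T1.connected ((hB1 z).1 hv')).symm
      · exact hs2.1.ne (((hA2 z).1 hv).antisymm T2.connected ((hB2 z).1 hv')).symm)
    (by
      intro v
      rcases disp_cases v with ⟨z, rfl⟩ | ⟨z, -, rfl⟩
      · rw [hA1, hB1]
        exact (btw_edge T1.acyclic hs1.1 z).symm
      · rw [hA2, hB2]
        exact (btw_edge T2.acyclic hs2.1 z).symm)
    (by
      intro u v hu hv huv
      rcases (disp_adj T1.leaf_inj T2.leaf_inj).1 huv with
        ⟨w, w', hw, rfl, rfl⟩ | ⟨w, w', hw, rfl, rfl⟩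
      · rw [hA1] at hu
        rw [hB1] at hv
        rcases PhyloTree.side_nbr hs1.1 hu hw with h | ⟨rfl, rfl⟩
        · exact absurd (h.antisymm T1.connected hv).symm hs1.1.ne
        · exact Or.inl ⟨rfl, rfl⟩
      · rw [hA2] at hu
        rw [hB2] at hv
        rcases PhyloTree.side_nbr hs2.1 hu hw with h | ⟨rfl, rfl⟩
        · exact absurd (h.antisymm T2.connected hv).symm hs2.1.ne
        · exact Or.inr ⟨rfl, rfl⟩)
  exact Nat.sInf_le hZ.toHas
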